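/- arXiv:2101.07701 — 7 statements merged into one kernel-verified Lean document; each statement's English description precedes it below -/
import Mathlib

section
/- With g and G as above, the rational-valued function (k, n) ↦ Σ_{i=1}^{n} g k i / 2^{i+1} (with each summand taken in ℚ) is a computable function ℕ × ℕ → ℚ, and for all k, n ∈ ℕ the real number G k satisfies |G k − (Σ_{i=1}^{n} g k i / 2^{i+1})| ≤ 2^{−n}. -/
/-- `g k i = 1` if machine `k` halts on input `k` within `i` steps, else `0` (real-valued). -/
noncomputable def haltStep (k i : ℕ) : ℝ :=
  if (Nat.Partrec.Code.evaln i (Denumerable.ofNat Nat.Partrec.Code k) k).isSome then 1 else 0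

/-- `G k = ∑_{i=1}^∞ g k i / 2^(i+1)`. -/
noncomputable def haltSum (k : ℕ) : ℝ :=
  ∑' i : ℕ, haltStep k (i + 1) / 2 ^ (i + 2)

/-- `g k i` as a rational number. -/
def haltStepQ (k i : ℕ) : ℚ :=
  if (Nat.Partrec.Code.evaln i (Denumerable.ofNat Nat.Partrec.Code k) k).isSome then 1 else 0

/-- The rational partial sum `∑_{i=1}^n g k i / 2^(i+1)`. -/
def haltPartialSum (k n : ℕ) : ℚ :=
  ∑ i ∈ Finset.range n, haltStepQ k (i + 1) / 2 ^ (i + 2)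

theorem Primrec.nat_count {p : ℕ → Prop} [DecidablePred p] (hp : PrimrecPred p) :
    Primrec (Nat.count p) :=
  (Primrec.list_length.comp ((Primrec.listFilter hp).comp Primrec.list_range)).of_eq fun n => by
    rw [Nat.count, List.countP_eq_length_filter]

theorem PrimrecRel.nat_dvd : PrimrecRel ((· ∣ ·) : ℕ → ℕ → Prop) :=
  PrimrecPred.of_eq
    (Primrec.eq.comp (Primrec.nat_mod.comp Primrec.snd Primrec.fst) (Primrec.const 0))
    fun _ => Nat.dvd_iff_mod_eq_zero.symm

theorem Nat.findGreatest_dvd_and_dvd (a b : ℕ) :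
    Nat.findGreatest (fun d => d ∣ a ∧ d ∣ b) (a + b) = a.gcd b := by
  rcases Nat.eq_zero_or_pos (a + b) with h | h
  · obtain ⟨rfl, rfl⟩ : a = 0 ∧ b = 0 := by omega
    simp
  · have hle : a.gcd b ≤ a + b := by
      rcases Nat.eq_zero_or_pos a with rfl | ha
      · simp
      · exact (Nat.gcd_le_left b ha).trans (Nat.le_add_right a b)
    have hpos : 0 < a.gcd b := Nat.gcd_pos_iff.2 (by omega)
    have hspec := Nat.findGreatest_spec (P := fun d => d ∣ a ∧ d ∣ b) hle
      ⟨Nat.gcd_dvd_left a b, Nat.gcd_dvd_right a b⟩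
    exact le_antisymm (Nat.le_of_dvd hpos (Nat.dvd_gcd hspec.1 hspec.2))
      (Nat.le_findGreatest hle ⟨Nat.gcd_dvd_left a b, Nat.gcd_dvd_right a b⟩)

theorem Primrec.nat_gcd : Primrec₂ Nat.gcd := by
  have hp : PrimrecRel fun (x : ℕ × ℕ) (d : ℕ) => d ∣ x.1 ∧ d ∣ x.2 :=
    PrimrecPred.and (PrimrecRel.nat_dvd.comp Primrec.snd (Primrec.fst.comp Primrec.fst))
      (PrimrecRel.nat_dvd.comp Primrec.snd (Primrec.snd.comp Primrec.fst))
  exact (Primrec.nat_findGreatest (Primrec.nat_add.comp Primrec.fst Primrec.snd) hp).of_eq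
    fun x => Nat.findGreatest_dvd_and_dvd x.1 x.2

theorem Primrec.nat_pow : Primrec₂ ((· ^ ·) : ℕ → ℕ → ℕ) :=
  Primrec₂.unpaired'.1 Nat.Primrec.pow

theorem Int.encode_natCast (n : ℕ) : Encodable.encode (n : ℤ) = 2 * n := rfl

theorem Int.encode_negSucc (n : ℕ) : Encodable.encode (Int.negSucc n) = 2 * n + 1 := rfl

theorem Int.natAbs_eq_encode (z : ℤ) : z.natAbs = (Encodable.encode z + 1) / 2 := by
  rcases z with n | n
  · rw [Int.ofNat_eq_natCast, Int.encode_natCast, Int.natAbs_natCast]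
    omega
  · rw [Int.encode_negSucc, Int.natAbs_negSucc]
    omega

namespace Rat

open Encodable

theorem encode_instEncodable (q : ℚ) :
    @encode ℚ Rat.instEncodable q = Nat.pair (encode q.num) q.den := rfl

theorem mem_range_encode_instEncodable (m : ℕ) :
    m ∈ Set.range (@encode ℚ Rat.instEncodable) ↔
      0 < m.unpair.2 ∧ Nat.gcd ((m.unpair.1 + 1) / 2) m.unpair.2 = 1 := by
  constructor
  · rintro ⟨q, rfl⟩
    rw [encode_instEncodable, Nat.unpair_pair, ← Int.natAbs_eq_encode]
    exact ⟨q.den_pos, q.reduced⟩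
  · rintro ⟨hd, hc⟩
    obtain ⟨z, hz⟩ : ∃ z : ℤ, encode z = m.unpair.1 :=
      ⟨Denumerable.ofNat ℤ m.unpair.1, Denumerable.encode_ofNat _⟩
    rw [← hz, ← Int.natAbs_eq_encode] at hc
    refine ⟨⟨z, m.unpair.2, hd.ne', hc⟩, ?_⟩
    rw [encode_instEncodable, hz, Nat.pair_unpair]

theorem encode_instDenumerable (q : ℚ) :
    @encode ℚ Rat.instDenumerable.toEncodable q =
      Nat.count (fun m => 0 < m.unpair.2 ∧ Nat.gcd ((m.unpair.1 + 1) / 2) m.unpair.2 = 1)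
        (Nat.pair (encode q.num) q.den) := by
  let := @decidableRangeEncode ℚ Rat.instEncodable
  have h : @encode ℚ Rat.instDenumerable.toEncodable q =
      Nat.count (fun m => m ∈ Set.range (@encode ℚ Rat.instEncodable))
        (@encode ℚ Rat.instEncodable q) := rfl
  rw [h, encode_instEncodable]
  simp only [mem_range_encode_instEncodable]

/-- A function into `ℚ` is primitive recursive as soon as its numerator and denominator are. -/
theorem primrec_of_num_den {α : Type*} [Primcodable α] {f : α → ℚ}
    (hnum : Primrec fun a => (f a).num) (hden : Primrec fun a => (f a).den) : Primrec f := by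
  have hp : PrimrecPred fun m : ℕ =>
      0 < m.unpair.2 ∧ Nat.gcd ((m.unpair.1 + 1) / 2) m.unpair.2 = 1 :=
    PrimrecPred.and
      (Primrec.nat_lt.comp (Primrec.const 0) (Primrec.snd.comp Primrec.unpair))
      (Primrec.eq.comp
        (Primrec.nat_gcd.comp
          (Primrec.nat_div.comp (Primrec.succ.comp (Primrec.fst.comp Primrec.unpair))
            (Primrec.const 2))
          (Primrec.snd.comp Primrec.unpair))
        (Primrec.const 1))
  refine Primrec.encode_iff.1 (((Primrec.nat_count hp).comp
    (Primrec₂.natPair.comp (Primrec.encode.comp hnum) hden)).of_eq fun a => ?_)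
  exact (encode_instDenumerable (f a)).symm

theorem primrec_natCast_div_natCast {α : Type*} [Primcodable α] {f g : α → ℕ}
    (hf : Primrec f) (hg : Primrec g) (hpos : ∀ a, 0 < g a) :
    Primrec fun a => (f a : ℚ) / (g a : ℚ) := by
  have hgcd : Primrec fun a => (f a).gcd (g a) := Primrec.nat_gcd.comp hf hg
  have hdiv (a : α) : (f a : ℚ) / (g a : ℚ) =
      ((f a / (f a).gcd (g a) : ℕ) : ℤ) / ((g a / (f a).gcd (g a) : ℕ) : ℤ) := by
    have hne : (((f a).gcd (g a) : ℕ) : ℚ) ≠ 0 :=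
      Nat.cast_ne_zero.2 (Nat.gcd_pos_of_pos_right _ (hpos a)).ne'
    rw [Int.cast_natCast, Int.cast_natCast, Nat.cast_div (Nat.gcd_dvd_left _ _) hne,
      Nat.cast_div (Nat.gcd_dvd_right _ _) hne, div_div_div_cancel_right₀ hne]
  have hb (a : α) : (0 : ℤ) < (g a / (f a).gcd (g a) : ℕ) :=
    Int.natCast_pos.2 (Nat.div_gcd_pos_of_pos_right _ (hpos a))
  have hcop (a : α) : Nat.Coprime ((f a / (f a).gcd (g a) : ℕ) : ℤ).natAbs
      ((g a / (f a).gcd (g a) : ℕ) : ℤ).natAbs :=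
    Nat.coprime_div_gcd_div_gcd (Nat.gcd_pos_of_pos_right _ (hpos a))
  refine primrec_of_num_den ?_ ?_
  · refine Primrec.encode_iff.1
      ((Primrec.nat_mul.comp (Primrec.const 2) (Primrec.nat_div.comp hf hgcd)).of_eq fun a => ?_)
    rw [hdiv, Rat.num_div_eq_of_coprime (hb a) (hcop a)]
    rfl
  · exact (Primrec.nat_div.comp hg hgcd).of_eq fun a => by
      rw [hdiv]
      exact (Nat.cast_injective (R := ℤ) (Rat.den_div_eq_of_coprime (hb a) (hcop a))).symm

end Rat

/-- The numerator of `haltPartialSum k n` over the denominator `2 ^ (n + 1)`. -/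
def haltNumerator (k n : ℕ) : ℕ :=
  n.rec 0 fun i N => 2 * N +
    if (Nat.Partrec.Code.evaln (i + 1) (Denumerable.ofNat Nat.Partrec.Code k) k).isSome
    then 1 else 0

theorem haltPartialSum_eq_div (k n : ℕ) :
    haltPartialSum k n = (haltNumerator k n : ℚ) / ((2 ^ (n + 1) : ℕ) : ℚ) := by
  induction n with
  | zero => simp [haltPartialSum, haltNumerator]
  | succ n ih =>
    have hN : haltNumerator k (n + 1) = 2 * haltNumerator k n +
      if (Nat.Partrec.Code.evaln (n + 1) (Denumerable.ofNat Nat.Partrec.Code k) k).isSome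
      then 1 else 0 := rfl
    have hS : haltPartialSum k (n + 1) =
        haltPartialSum k n + haltStepQ k (n + 1) / 2 ^ (n + 2) := Finset.sum_range_succ _ _
    rw [hS, ih, hN, haltStepQ]
    push_cast
    field_simp
    ring

theorem primrec_haltNumerator : Primrec₂ haltNumerator := by
  have hev : Primrec fun x : (ℕ × ℕ) × ℕ × ℕ => Nat.Partrec.Code.evaln (x.2.1 + 1)
      (Denumerable.ofNat Nat.Partrec.Code x.1.1) x.1.1 :=
    Nat.Partrec.Code.primrec_evaln.comp
      (((Primrec.succ.comp (Primrec.fst.comp Primrec.snd)).pair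
        ((Primrec.ofNat _).comp (Primrec.fst.comp Primrec.fst))).pair
        (Primrec.fst.comp Primrec.fst))
  refine Primrec.nat_rec' (h := fun (x : ℕ × ℕ) (y : ℕ × ℕ) => 2 * y.2 +
    if (Nat.Partrec.Code.evaln (y.1 + 1) (Denumerable.ofNat Nat.Partrec.Code x.1) x.1).isSome
    then 1 else 0) Primrec.snd (Primrec.const 0) ?_
  exact Primrec.nat_add.comp
    (Primrec.nat_mul.comp (Primrec.const 2) (Primrec.snd.comp Primrec.snd))
    (Primrec.ite (Primrec.eq.comp (Primrec.option_isSome.comp hev) (Primrec.const true))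
      (Primrec.const 1) (Primrec.const 0))

theorem primrec_haltPartialSum : Primrec₂ haltPartialSum :=
  (Rat.primrec_natCast_div_natCast primrec_haltNumerator
    (Primrec.nat_pow.comp (Primrec.const 2) (Primrec.succ.comp Primrec.snd))
    fun _ => by positivity).of_eq fun x => (haltPartialSum_eq_div x.1 x.2).symm

theorem haltStep_nonneg (k i : ℕ) : 0 ≤ haltStep k i := by
  unfold haltStep
  split_ifs <;> norm_num

theorem haltStep_le_one (k i : ℕ) : haltStep k i ≤ 1 := by
  unfold haltStep
  split_ifs <;> norm_num

theorem haltPartialSum_cast (k n : ℕ) :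
    (haltPartialSum k n : ℝ) = ∑ i ∈ Finset.range n, haltStep k (i + 1) / 2 ^ (i + 2) := by
  simp [haltPartialSum, haltStepQ, haltStep, apply_ite]

theorem hasSum_one_div_two_pow_add_two (n : ℕ) :
    HasSum (fun i : ℕ => (1 : ℝ) / 2 ^ (i + n + 2)) (1 / 2 ^ (n + 1)) := by
  have hterm : (fun i : ℕ => (1 : ℝ) / 2 ^ (i + n + 2)) =
      fun i => (1 / 2) ^ i * (1 / 2 ^ (n + 2)) := by
    funext i
    rw [one_div_pow, div_mul_div_comm, ← pow_add, one_mul, add_assoc]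
  have hsum : (1 : ℝ) / 2 ^ (n + 1) = 2 * (1 / 2 ^ (n + 2)) := by
    rw [pow_succ (2 : ℝ) (n + 1)]
    field_simp
  rw [hterm, hsum]
  exact hasSum_geometric_two.mul_right _

theorem summable_haltStep_div (k : ℕ) :
    Summable fun i : ℕ => haltStep k (i + 1) / 2 ^ (i + 2) :=
  (hasSum_one_div_two_pow_add_two 0).summable.of_nonneg_of_le
    (fun i => div_nonneg (haltStep_nonneg k (i + 1)) (by positivity))
    fun i => by
      rw [add_zero]
      gcongr
      exact haltStep_le_one k (i + 1)

theorem abs_haltSum_sub_haltPartialSum_le (k n : ℕ) :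
    |haltSum k - (haltPartialSum k n : ℝ)| ≤ 1 / 2 ^ (n + 1) := by
  have hs := summable_haltStep_div k
  have htail : haltSum k - (haltPartialSum k n : ℝ) =
      ∑' i : ℕ, haltStep k (i + n + 1) / 2 ^ (i + n + 2) := by
    rw [haltPartialSum_cast, haltSum, ← hs.sum_add_tsum_nat_add n, add_sub_cancel_left]
  have hnonneg (i : ℕ) : 0 ≤ haltStep k (i + n + 1) / 2 ^ (i + n + 2) :=
    div_nonneg (haltStep_nonneg k _) (by positivity)
  rw [htail, abs_of_nonneg (tsum_nonneg hnonneg), ← (hasSum_one_div_two_pow_add_two n).tsum_eq]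
  refine Summable.tsum_le_tsum (fun i => ?_) ((summable_nat_add_iff n).2 hs)
    (hasSum_one_div_two_pow_add_two n).summable
  gcongr
  exact haltStep_le_one k _

theorem stmt1 :
    Computable (fun p : ℕ × ℕ => haltPartialSum p.1 p.2) ∧
    ∀ k n : ℕ, |haltSum k - (haltPartialSum k n : ℝ)| ≤ 2 ^ (-(n : ℤ)) := by
  refine ⟨primrec_haltPartialSum.to_comp, fun k n =>
    (abs_haltSum_sub_haltPartialSum_le k n).trans ?_⟩
  rw [zpow_neg, zpow_natCast, one_div]
  gcongr
  · norm_num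
  · exact Nat.le_succ n
end

section
/- Let P : ℝ → ℝ be continuous and let x : ℝ → ℝ × ℝ be a periodic solution of the system x' = F_P(x), i.e. there is T > 0 with x(t + T) = x(t) for all t. Writing x(t) = (x₁(t), x₂(t)), the quantity x₁(t)² + x₂(t)² is constant in t, and either x(0) = (0,0) or P(x₁(0)² + x₂(0)²) = 0. -/
/-- The planar vector field `F_P(x₁,x₂) = (−x₂ + x₁·P(x₁²+x₂²), x₁ + x₂·P(x₁²+x₂²))`. -/
def planarField (P : ℝ → ℝ) (x : ℝ × ℝ) : ℝ × ℝ :=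
  (-x.2 + x.1 * P (x.1 ^ 2 + x.2 ^ 2), x.1 + x.2 * P (x.1 ^ 2 + x.2 ^ 2))

/-- A monotone periodic function on the reals is constant. -/
theorem Monotone.eq_of_periodic {W : ℝ → ℝ} (hW : Monotone W) {T : ℝ} (hT : 0 < T)
    (hper : Function.Periodic W T) (s t : ℝ) : W s = W t := by
  have key : ∀ a b : ℝ, W b ≤ W a := by
    intro a b
    obtain ⟨n, hn⟩ := exists_nat_ge ((b - a) / T)
    rw [div_le_iff₀ hT] at hn
    calc W b ≤ W (a + n * T) := hW (by linarith)
      _ = W a := hper.nat_mul n a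
  exact le_antisymm (key t s) (key s t)

/-- A periodic solution of a scalar autonomous equation `u' = g(u)` with `g` continuous is
stationary. -/
theorem Function.Periodic.apply_eq_zero_of_hasDerivAt {g u : ℝ → ℝ} (hg : Continuous g)
    (hu : ∀ t, HasDerivAt u (g (u t)) t) {T : ℝ} (hT : 0 < T) (hper : Function.Periodic u T)
    (t : ℝ) : g (u t) = 0 := by
  have hW : ∀ t, HasDerivAt (fun s ↦ ∫ y in (0 : ℝ)..u s, g y) (g (u t) * g (u t)) t := fun t ↦
    (hg.integral_hasStrictDerivAt 0 (u t)).hasDerivAt.comp t (hu t)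
  have hmono : Monotone (fun s ↦ ∫ y in (0 : ℝ)..u s, g y) :=
    monotone_of_hasDerivAt_nonneg hW fun t ↦ mul_self_nonneg _
  have hconst := hmono.eq_of_periodic hT (fun s ↦ by simp only [hper s])
  have hzero : HasDerivAt (fun s ↦ ∫ y in (0 : ℝ)..u s, g y) 0 t :=
    (hasDerivAt_const t (∫ y in (0 : ℝ)..u 0, g y)).congr_of_eventuallyEq
      (Filter.Eventually.of_forall fun s ↦ hconst s 0)
  exact mul_self_eq_zero.mp ((hW t).unique hzero)

/-- The squared radius along a solution of the planar system satisfies `u' = 2 u P(u)`. -/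
theorem hasDerivAt_sq_add_sq_of_planarField {P : ℝ → ℝ} {x : ℝ → ℝ × ℝ} {t : ℝ}
    (hx : HasDerivAt x (planarField P (x t)) t) :
    HasDerivAt (fun s ↦ (x s).1 ^ 2 + (x s).2 ^ 2)
      (2 * ((x t).1 ^ 2 + (x t).2 ^ 2) * P ((x t).1 ^ 2 + (x t).2 ^ 2)) t := by
  have h1 : HasDerivAt (fun s ↦ (x s).1) (planarField P (x t)).1 t :=
    (hasFDerivAt_fst (𝕜 := ℝ) (p := x t)).comp_hasDerivAt t hx
  have h2 : HasDerivAt (fun s ↦ (x s).2) (planarField P (x t)).2 t :=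
    (hasFDerivAt_snd (𝕜 := ℝ) (p := x t)).comp_hasDerivAt t hx
  refine ((h1.fun_pow 2).fun_add (h2.fun_pow 2)).congr_deriv ?_
  simp only [planarField]
  push_cast
  ring

theorem stmt4 (P : ℝ → ℝ) (hP : Continuous P) (x : ℝ → ℝ × ℝ)
    (hx : ∀ t : ℝ, HasDerivAt x (planarField P (x t)) t)
    (T : ℝ) (hT : 0 < T) (hper : ∀ t : ℝ, x (t + T) = x t) :
    (∀ t : ℝ, (x t).1 ^ 2 + (x t).2 ^ 2 = (x 0).1 ^ 2 + (x 0).2 ^ 2) ∧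
    (x 0 = (0, 0) ∨ P ((x 0).1 ^ 2 + (x 0).2 ^ 2) = 0) := by
  have hu := fun t ↦ hasDerivAt_sq_add_sq_of_planarField (hx t)
  have hzero : ∀ t, 2 * ((x t).1 ^ 2 + (x t).2 ^ 2) * P ((x t).1 ^ 2 + (x t).2 ^ 2) = 0 :=
    Function.Periodic.apply_eq_zero_of_hasDerivAt (g := fun r ↦ 2 * r * P r)
      (by fun_prop) hu hT (fun t ↦ by simp only [hper t])
  constructor
  · intro t
    exact is_const_of_deriv_eq_zero (fun t ↦ (hu t).differentiableAt)
      (fun t ↦ (hu t).deriv.trans (hzero t)) t 0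
  · rcases mul_eq_zero.mp (hzero 0) with h | h
    · left
      ext
      · show (x 0).1 = 0
        nlinarith [sq_nonneg (x 0).1, sq_nonneg (x 0).2]
      · show (x 0).2 = 0
        nlinarith [sq_nonneg (x 0).1, sq_nonneg (x 0).2]
    · exact Or.inr h
end

section
/- Let P : ℝ → ℝ be continuous. A set S ⊆ ℝ × ℝ is the range of a nonconstant periodic solution of the system x' = F_P(x) if and only if there exists c > 0 with P(c) = 0 such that S = {(x₁, x₂) | x₁² + x₂² = c}. Consequently the number of distinct periodic orbits of x' = F_P(x) equals the number of distinct positive roots of P. -/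
/-- `S` is a periodic orbit of `x' = F_P(x)`: the range of a nonconstant periodic solution. -/
def IsPeriodicOrbit (P : ℝ → ℝ) (S : Set (ℝ × ℝ)) : Prop :=
  ∃ x : ℝ → ℝ × ℝ, (∀ t : ℝ, HasDerivAt x (planarField P (x t)) t) ∧
    (∃ T : ℝ, 0 < T ∧ ∀ t : ℝ, x (t + T) = x t) ∧
    (¬ ∃ p : ℝ × ℝ, ∀ t : ℝ, x t = p) ∧
    S = Set.range x

theorem exists_cos_sin_eq {a b : ℝ} (h : a ^ 2 + b ^ 2 = 1) :
    ∃ θ : ℝ, Real.cos θ = a ∧ Real.sin θ = b := by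
  have hz : ‖(⟨a, b⟩ : ℂ)‖ = 1 := by
    rw [Complex.norm_def, Complex.normSq_mk, Real.sqrt_eq_one]
    linarith
  have hz0 : (⟨a, b⟩ : ℂ) ≠ 0 := by
    intro h0
    simp [h0] at hz
  refine ⟨Complex.arg ⟨a, b⟩, ?_, ?_⟩
  · rw [Complex.cos_arg hz0, hz, div_one]
  · rw [Complex.sin_arg, hz, div_one]

/-- The orbit of a nonzero point under rotations is the circle through it. -/
theorem range_rotation {a b c : ℝ} (hc : 0 < c) (h : a ^ 2 + b ^ 2 = c) :
    Set.range (fun t : ℝ ↦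
      (a * Real.cos t - b * Real.sin t, a * Real.sin t + b * Real.cos t)) =
      {p : ℝ × ℝ | p.1 ^ 2 + p.2 ^ 2 = c} := by
  ext ⟨p, q⟩
  simp only [Set.mem_range, Set.mem_ofPred_eq, Prod.mk.injEq]
  constructor
  · rintro ⟨t, rfl, rfl⟩
    linear_combination h + (a ^ 2 + b ^ 2) * Real.sin_sq_add_cos_sq t
  · intro hpq
    obtain ⟨θ, h1, h2⟩ := exists_cos_sin_eq
      (a := (a * p + b * q) / c) (b := (a * q - b * p) / c) (by
        field_simp
        linear_combination (p ^ 2 + q ^ 2) * h + c * hpq)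
    refine ⟨θ, ?_, ?_⟩
    · rw [h1, h2]
      field_simp
      linear_combination p * h
    · rw [h1, h2]
      field_simp
      linear_combination q * h

/-- A periodic solution of a scalar autonomous equation with continuous right-hand side is an
equilibrium. -/
theorem autonomous_periodic_eq_zero {g r : ℝ → ℝ} (hg : Continuous g)
    (hr : ∀ t, HasDerivAt r (g (r t)) t) {T : ℝ} (hT : 0 < T) (hper : Function.Periodic r T)
    (t : ℝ) : g (r t) = 0 := by
  have hG : ∀ s, HasDerivAt (fun s ↦ ∫ u in (0 : ℝ)..r s, g u) (g (r s) * g (r s)) s :=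
    fun s ↦ (hg.integral_hasStrictDerivAt 0 (r s)).hasDerivAt.comp s (hr s)
  set H : ℝ → ℝ := fun s ↦ ∫ u in (0 : ℝ)..r s, g u with hH
  have hmono : Monotone H := monotone_of_deriv_nonneg (fun s ↦ (hG s).differentiableAt)
    fun s ↦ by rw [(hG s).deriv]; exact mul_self_nonneg _
  have hHper : Function.Periodic H T := fun s ↦ by simp only [hH, hper s]
  have hconst : ∀ s, H s = H 0 := by
    intro s
    obtain ⟨n, hn⟩ := exists_nat_gt (|s| / T)
    rw [div_lt_iff₀ hT] at hn
    have h1 := hmono (show s ≤ 0 + n * T by linarith [le_abs_self s])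
    have h2 := hmono (show 0 ≤ s + n * T by linarith [neg_abs_le s])
    rw [hHper.nat_mul n] at h1 h2
    exact le_antisymm h1 h2
  have h0 : HasDerivAt H 0 t := by
    rw [show H = fun _ ↦ H 0 from funext hconst]
    exact hasDerivAt_const t _
  exact mul_self_eq_zero.mp ((hG t).unique h0)

theorem HasDerivAt.eq_of_zero {f : ℝ → ℝ} (h : ∀ t, HasDerivAt f 0 t) (s t : ℝ) : f s = f t :=
  is_const_of_deriv_eq_zero (fun t ↦ (h t).differentiableAt) (fun t ↦ (h t).deriv) s t

theorem eq_rotation_of_hasDerivAt {u v : ℝ → ℝ} (hu : ∀ t, HasDerivAt u (-v t) t)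
    (hv : ∀ t, HasDerivAt v (u t) t) (t : ℝ) :
    u t = u 0 * Real.cos t - v 0 * Real.sin t ∧ v t = u 0 * Real.sin t + v 0 * Real.cos t := by
  have h1 : ∀ t, HasDerivAt (fun t ↦ u t * Real.cos t + v t * Real.sin t) 0 t := fun t ↦ by
    refine (((hu t).mul (Real.hasDerivAt_cos t)).add
      ((hv t).mul (Real.hasDerivAt_sin t))).congr_deriv ?_
    ring
  have h2 : ∀ t, HasDerivAt (fun t ↦ v t * Real.cos t - u t * Real.sin t) 0 t := fun t ↦ by
    refine (((hv t).mul (Real.hasDerivAt_cos t)).sub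
      ((hu t).mul (Real.hasDerivAt_sin t))).congr_deriv ?_
    ring
  have e1 := HasDerivAt.eq_of_zero h1 t 0
  have e2 := HasDerivAt.eq_of_zero h2 t 0
  simp only [Real.cos_zero, Real.sin_zero, mul_one, mul_zero, add_zero, sub_zero] at e1 e2
  rw [← e1, ← e2]
  constructor
  · linear_combination -u t * Real.sin_sq_add_cos_sq t
  · linear_combination -v t * Real.sin_sq_add_cos_sq t

theorem IsPeriodicOrbit.exists_root {P : ℝ → ℝ} (hP : Continuous P) {S : Set (ℝ × ℝ)}
    (h : IsPeriodicOrbit P S) :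
    ∃ c : ℝ, 0 < c ∧ P c = 0 ∧ S = {p : ℝ × ℝ | p.1 ^ 2 + p.2 ^ 2 = c} := by
  obtain ⟨x, hx, ⟨T, hT, hper⟩, hne, rfl⟩ := h
  have hu : ∀ t, HasDerivAt (fun t ↦ (x t).1) (planarField P (x t)).1 t :=
    fun t ↦ (hx t).fst
  have hv : ∀ t, HasDerivAt (fun t ↦ (x t).2) (planarField P (x t)).2 t :=
    fun t ↦ (hx t).snd
  set r : ℝ → ℝ := fun t ↦ (x t).1 ^ 2 + (x t).2 ^ 2 with hr_def
  have hr : ∀ t, HasDerivAt r (2 * r t * P (r t)) t := fun t ↦ by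
    refine (((hu t).pow 2).add ((hv t).pow 2)).congr_deriv ?_
    simp only [planarField, hr_def]
    push_cast
    ring
  have hzero : ∀ t, 2 * r t * P (r t) = 0 :=
    autonomous_periodic_eq_zero (g := fun s ↦ 2 * s * P s) (by fun_prop) hr hT
      fun t ↦ by simp only [hr_def, hper t]
  have hconst : ∀ t, r t = r 0 :=
    fun t ↦ HasDerivAt.eq_of_zero (fun s ↦ hzero s ▸ hr s) t 0
  have hpos : 0 < r 0 := by
    refine lt_of_le_of_ne (by positivity) fun h0 ↦ hne ⟨0, fun t ↦ ?_⟩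
    have ht : (x t).1 ^ 2 + (x t).2 ^ 2 = 0 := (hconst t).trans h0.symm
    ext
    · exact pow_eq_zero_iff two_ne_zero |>.mp (by nlinarith [sq_nonneg (x t).1, sq_nonneg (x t).2])
    · exact pow_eq_zero_iff two_ne_zero |>.mp (by nlinarith [sq_nonneg (x t).1, sq_nonneg (x t).2])
  have hroot : P (r 0) = 0 := (mul_eq_zero.mp (hzero 0)).resolve_left (by positivity)
  have hPt : ∀ t, P ((x t).1 ^ 2 + (x t).2 ^ 2) = 0 := fun t ↦ by
    rw [show (x t).1 ^ 2 + (x t).2 ^ 2 = r 0 from hconst t, hroot]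
  refine ⟨r 0, hpos, hroot, ?_⟩
  rw [← range_rotation hpos rfl]
  congr 1
  ext1 t
  have hrot := eq_rotation_of_hasDerivAt (u := fun t ↦ (x t).1) (v := fun t ↦ (x t).2)
    (fun t ↦ by simpa [planarField, hPt t] using hu t)
    (fun t ↦ by simpa [planarField, hPt t] using hv t) t
  exact Prod.ext hrot.1 hrot.2

theorem isPeriodicOrbit_circle {P : ℝ → ℝ} {c : ℝ} (hc : 0 < c) (hroot : P c = 0) :
    IsPeriodicOrbit P {p : ℝ × ℝ | p.1 ^ 2 + p.2 ^ 2 = c} := by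
  have hsq : √c ^ 2 = c := Real.sq_sqrt hc.le
  refine ⟨fun t ↦ (√c * Real.cos t - 0 * Real.sin t, √c * Real.sin t + 0 * Real.cos t),
    fun t ↦ ?_, ⟨2 * Real.pi, Real.two_pi_pos, fun t ↦ by simp⟩, ?_, ?_⟩
  · have hcirc : (√c * Real.cos t) ^ 2 + (√c * Real.sin t) ^ 2 = c := by
      linear_combination hsq + √c ^ 2 * Real.sin_sq_add_cos_sq t
    simp only [planarField, zero_mul, sub_zero, add_zero, hcirc, hroot, mul_zero]
    convert ((Real.hasDerivAt_cos t).const_mul √c).prodMk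
      ((Real.hasDerivAt_sin t).const_mul √c) using 2
    ring
  · rintro ⟨p, hp⟩
    have h := congrArg Prod.fst ((hp 0).trans (hp Real.pi).symm)
    have := Real.sqrt_pos.mpr hc
    simp at h
    linarith
  · exact (range_rotation hc (by simpa using hsq)).symm

theorem isPeriodicOrbit_iff {P : ℝ → ℝ} (hP : Continuous P) (S : Set (ℝ × ℝ)) :
    IsPeriodicOrbit P S ↔
      ∃ c : ℝ, 0 < c ∧ P c = 0 ∧ S = {p : ℝ × ℝ | p.1 ^ 2 + p.2 ^ 2 = c} := by
  refine ⟨fun h ↦ h.exists_root hP, ?_⟩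
  rintro ⟨c, hc, hroot, rfl⟩
  exact isPeriodicOrbit_circle hc hroot

theorem stmt5 (P : ℝ → ℝ) (hP : Continuous P) :
    (∀ S : Set (ℝ × ℝ), IsPeriodicOrbit P S ↔
      ∃ c : ℝ, 0 < c ∧ P c = 0 ∧ S = {p : ℝ × ℝ | p.1 ^ 2 + p.2 ^ 2 = c}) ∧
    {S : Set (ℝ × ℝ) | IsPeriodicOrbit P S}.ncard = {c : ℝ | 0 < c ∧ P c = 0}.ncard := by
  refine ⟨isPeriodicOrbit_iff hP, ?_⟩
  have himage : {S : Set (ℝ × ℝ) | IsPeriodicOrbit P S} =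
      (fun c : ℝ ↦ {p : ℝ × ℝ | p.1 ^ 2 + p.2 ^ 2 = c}) '' {c : ℝ | 0 < c ∧ P c = 0} := by
    ext S
    simp only [Set.mem_ofPred_eq, isPeriodicOrbit_iff hP, Set.mem_image, and_assoc, eq_comm]
  rw [himage]
  refine Set.InjOn.ncard_image fun c hc d _ hcd ↦ ?_
  have hmem : ((√c, 0) : ℝ × ℝ) ∈ {p : ℝ × ℝ | p.1 ^ 2 + p.2 ^ 2 = c} := by
    simp [Real.sq_sqrt hc.1.le]
  have hd : √c ^ 2 + (0 : ℝ) ^ 2 = d := hcd.subset hmem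
  rw [Real.sq_sqrt hc.1.le] at hd
  linarith
end

section
/- (Global error bound for Euler's method with rounding.) Let f : ℝ² → ℝ² be Lipschitz with constant L > 0, let t₀ ≤ b, and let x : ℝ → ℝ² satisfy x'(t) = f(x(t)) for all t ∈ [t₀, b], with x' differentiable on [t₀, b] and ‖x''(t)‖ ≤ C for all t ∈ [t₀, b]. Let h > 0, ρ ≥ 0, and let y : ℕ → ℝ² satisfy ‖y_{n+1} − (y_n + h·f(y_n))‖ ≤ ρ for all n. Then for every n ∈ ℕ with t₀ + n·h ≤ b, ‖y_n − x(t₀ + n·h)‖ ≤ e^{(b−t₀)L}·‖y₀ − x(t₀)‖ + ((e^{(b−t₀)L} − 1)/L)·(h·C/2 + ρ/h). -/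
/-- First-order Taylor estimate with a bound on the second derivative. -/
theorem norm_sub_sub_smul_le_of_norm_deriv2_le {E : Type*} [NormedAddCommGroup E]
    [NormedSpace ℝ E] {x x' x'' : ℝ → E} {a c C : ℝ} (hac : a ≤ c)
    (hx : ∀ t ∈ Set.Icc a c, HasDerivAt x (x' t) t)
    (hx' : ∀ t ∈ Set.Icc a c, HasDerivAt x' (x'' t) t)
    (hC : ∀ t ∈ Set.Icc a c, ‖x'' t‖ ≤ C) :
    ‖x c - x a - (c - a) • x' a‖ ≤ C * (c - a) ^ 2 / 2 := by
  have hbound : ∀ t ∈ Set.Icc a c, ‖x' t - x' a‖ ≤ C * (t - a) :=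
    norm_image_sub_le_of_norm_deriv_le_segment'
      (fun t ht => (hx' t ht).hasDerivWithinAt)
      (fun t ht => hC t (Set.Ico_subset_Icc_self ht))
  have hderiv : ∀ t ∈ Set.Icc a c,
      HasDerivAt (fun t => x t - x a - (t - a) • x' a) (x' t - x' a) t := by
    intro t ht
    have h1 := ((hasDerivAt_id t).sub_const a).smul_const (x' a)
    simpa using ((hx t ht).sub_const (x a)).fun_sub h1
  have hB : ∀ t : ℝ, HasDerivAt (fun t => C * (t - a) ^ 2 / 2) (C * (t - a)) t := by
    intro t
    have h1 := ((((hasDerivAt_id t).sub_const a).pow 2).const_mul C).div_const 2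
    refine h1.congr_deriv ?_
    simp only [id]
    push_cast
    ring
  refine image_norm_le_of_norm_deriv_right_le_deriv_boundary
    (f := fun t => x t - x a - (t - a) • x' a)
    (fun t ht => (hderiv t ht).continuousAt.continuousWithinAt)
    (fun t ht => (hderiv t (Set.Ico_subset_Icc_self ht)).hasDerivWithinAt)
    (by simp) hB (fun t ht => hbound t (Set.Ico_subset_Icc_self ht)) ⟨hac, le_rfl⟩

/-- One Euler step with rounding amplifies the error by at most `1 + h * L`, up to the local
truncation error and the rounding error. -/
theorem LipschitzWith.norm_euler_step_sub_le {E : Type*} [NormedAddCommGroup E]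
    [NormedSpace ℝ E] {f : E → E} {L : NNReal} (hf : LipschitzWith L f) {h ρ τ : ℝ} (hh : 0 ≤ h)
    {u u' v v' : E} (hu : ‖u' - (u + h • f u)‖ ≤ ρ) (hv : ‖v' - v - h • f v‖ ≤ τ) :
    ‖u' - v'‖ ≤ (1 + h * L) * ‖u - v‖ + (τ + ρ) := by
  have hlip : ‖h • (f u - f v)‖ ≤ h * (L * ‖u - v‖) := by
    rw [norm_smul, Real.norm_of_nonneg hh]
    exact mul_le_mul_of_nonneg_left (hf.norm_sub_le u v) hh
  have hsplit : u' - v' =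
      (u' - (u + h • f u)) + (u - v) + h • (f u - f v) - (v' - v - h • f v) := by
    rw [smul_sub]
    abel
  rw [hsplit]
  have h1 := _root_.norm_sub_le ((u' - (u + h • f u)) + (u - v) + h • (f u - f v)) (v' - v - h • f v)
  have h2 := norm_add₃_le (a := u' - (u + h • f u)) (b := u - v) (c := h • (f u - f v))
  linarith

theorem stmt10 (f : EuclideanSpace ℝ (Fin 2) → EuclideanSpace ℝ (Fin 2))
    (L : NNReal) (hL : 0 < (L : ℝ)) (hf : LipschitzWith L f)
    (t₀ b : ℝ) (htb : t₀ ≤ b)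
    (x x' x'' : ℝ → EuclideanSpace ℝ (Fin 2))
    (hx : ∀ t ∈ Set.Icc t₀ b, HasDerivAt x (x' t) t)
    (hx'f : ∀ t ∈ Set.Icc t₀ b, x' t = f (x t))
    (hx'' : ∀ t ∈ Set.Icc t₀ b, HasDerivAt x' (x'' t) t)
    (C : ℝ) (hC : ∀ t ∈ Set.Icc t₀ b, ‖x'' t‖ ≤ C)
    (h : ℝ) (hh : 0 < h) (ρ : ℝ) (hρ : 0 ≤ ρ)
    (y : ℕ → EuclideanSpace ℝ (Fin 2))
    (hy : ∀ n : ℕ, ‖y (n + 1) - (y n + h • f (y n))‖ ≤ ρ) :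
    ∀ n : ℕ, t₀ + n * h ≤ b →
      ‖y n - x (t₀ + n * h)‖ ≤
        Real.exp ((b - t₀) * L) * ‖y 0 - x t₀‖ +
          ((Real.exp ((b - t₀) * L) - 1) / L) * (h * C / 2 + ρ / h) := by
  have hC0 : 0 ≤ C := (norm_nonneg _).trans (hC t₀ ⟨le_rfl, htb⟩)
  have hD : 0 ≤ h * C / 2 + ρ / h := by positivity
  have hgrowth : ∀ n : ℕ, t₀ + n * h ≤ b →
      ‖y n - x (t₀ + n * h)‖ ≤ (1 + h * L) ^ n * ‖y 0 - x t₀‖ +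
        (((1 + h * L) ^ n - 1) / L) * (h * C / 2 + ρ / h) := by
    intro n
    induction n with
    | zero => simp
    | succ n ih =>
      intro hn
      have hnext : t₀ + ((n + 1 : ℕ) : ℝ) * h = t₀ + n * h + h := by
        push_cast
        ring
      rw [hnext] at hn ⊢
      have hnh : 0 ≤ (n : ℝ) * h := by positivity
      have hsub : Set.Icc (t₀ + n * h) (t₀ + n * h + h) ⊆ Set.Icc t₀ b :=
        Set.Icc_subset_Icc (by linarith) hn
      have htaylor := norm_sub_sub_smul_le_of_norm_deriv2_le (by linarith)
        (fun t ht => hx t (hsub ht)) (fun t ht => hx'' t (hsub ht)) (fun t ht => hC t (hsub ht))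
      rw [add_sub_cancel_left, hx'f _ (hsub ⟨le_rfl, by linarith⟩)] at htaylor
      calc ‖y (n + 1) - x (t₀ + n * h + h)‖
          ≤ (1 + h * L) * ‖y n - x (t₀ + n * h)‖ + (C * h ^ 2 / 2 + ρ) :=
            hf.norm_euler_step_sub_le hh.le (hy n) htaylor
        _ ≤ (1 + h * L) * ((1 + h * L) ^ n * ‖y 0 - x t₀‖ +
              (((1 + h * L) ^ n - 1) / L) * (h * C / 2 + ρ / h)) + (C * h ^ 2 / 2 + ρ) := by
            gcongr
            exact ih (by linarith)
        _ = _ := by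
            field_simp
            ring
  intro n hn
  have hpow : (1 + h * (L : ℝ)) ^ n ≤ Real.exp ((b - t₀) * L) := by
    calc (1 + h * (L : ℝ)) ^ n ≤ Real.exp (h * L) ^ n := by
          gcongr
          linarith [Real.add_one_le_exp (h * (L : ℝ))]
      _ = Real.exp (n * h * L) := by rw [← Real.exp_nat_mul, mul_assoc]
      _ ≤ Real.exp ((b - t₀) * L) := by
          gcongr
          linarith
  refine (hgrowth n hn).trans ?_
  gcongr
end

section
/- (Exponential convergence near a sink.) Let f : ℝ² → ℝ² be continuously differentiable, let x₀ ∈ ℝ² with f(x₀) = 0, and let A be the 2×2 real matrix representing the derivative of f at x₀. Let α > 0 and assume that every eigenvalue μ ∈ spectrum ℂ of the complexification of A satisfies Re μ < −α. Then for every ε > 0 there exists δ > 0 such that every solution x : ℝ → ℝ² of x' = f(x) defined for all t ≥ 0 with ‖x(0) − x₀‖ < δ satisfies ‖x(t) − x₀‖ ≤ ε·e^{−αt} for all t ≥ 0. -/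
/-- If all complex eigenvalues of a real `2 × 2` matrix have real part `< -α`, then `A + α` has
negative trace and positive determinant. -/
theorem trace_neg_and_det_pos_of_spectrum_re_lt (A : Matrix (Fin 2) (Fin 2) ℝ) (α : ℝ)
    (h : ∀ μ ∈ spectrum ℂ (A.map (algebraMap ℝ ℂ)), μ.re < -α) :
    (A 0 0 + α) + (A 1 1 + α) < 0 ∧ 0 < (A 0 0 + α) * (A 1 1 + α) - A 0 1 * A 1 0 := by
  have hmem : ∀ μ : ℂ, μ ∈ spectrum ℂ (A.map (algebraMap ℝ ℂ)) ↔
      (μ - A 0 0) * (μ - A 1 1) - A 0 1 * A 1 0 = 0 := by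
    intro μ
    rw [spectrum.mem_iff, Matrix.isUnit_iff_isUnit_det, isUnit_iff_ne_zero, not_not,
      Matrix.det_fin_two]
    simp [Matrix.algebraMap_matrix_apply]
  obtain ⟨μ, hμ⟩ := spectrum.nonempty_of_isAlgClosed_of_finiteDimensional ℂ
    (A.map (algebraMap ℝ ℂ))
  have h₁ := (hmem μ).1 hμ
  have hν : ((A 0 0 + A 1 1 : ℝ) : ℂ) - μ ∈ spectrum ℂ (A.map (algebraMap ℝ ℂ)) := by
    rw [hmem, ← h₁]
    push_cast
    ring
  have hμre := h _ hμ
  have hνre := h _ hν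
  have hre := congrArg Complex.re h₁
  have him := congrArg Complex.im h₁
  simp only [Complex.sub_re, Complex.sub_im, Complex.mul_re, Complex.mul_im, Complex.ofReal_re,
    Complex.ofReal_im, Complex.zero_re, Complex.zero_im] at hνre hre him
  constructor
  · linarith
  · have hprod := mul_pos (sub_pos.2 hμre) (sub_pos.2 hνre)
    nlinarith [sq_nonneg μ.im]

/-- A differential inequality `V' ≤ -c V` valid below a level `R` forces exponential decay of
nonnegative initial data below that level. -/
theorem le_mul_exp_of_hasDerivAt_le_below_level {V V' : ℝ → ℝ} {c R : ℝ} (hc : 0 ≤ c)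
    (hderiv : ∀ t, 0 ≤ t → HasDerivAt V (V' t) t)
    (hle : ∀ t, 0 ≤ t → V t < R → V' t ≤ -c * V t) (hV0 : 0 ≤ V 0) (hR : V 0 < R)
    {t : ℝ} (ht : 0 ≤ t) : V t ≤ V 0 * Real.exp (-c * t) := by
  have hcont : ContinuousOn V (Set.Ici 0) := fun t ht =>
    (hderiv t ht).continuousAt.continuousWithinAt
  have key : ∀ T, 0 ≤ T → (∀ s, 0 ≤ s → s < T → V s < R) → V T ≤ V 0 * Real.exp (-c * T) := by
    intro T hT hlt
    have hW : ∀ s, 0 ≤ s → HasDerivAt (fun s => V s * Real.exp (c * s))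
        (V' s * Real.exp (c * s) + V s * (Real.exp (c * s) * (c * 1))) s := fun s hs =>
      (hderiv s hs).mul ((hasDerivAt_id s).const_mul c).exp
    have hanti : AntitoneOn (fun s => V s * Real.exp (c * s)) (Set.Icc 0 T) := by
      apply antitoneOn_of_hasDerivWithinAt_nonpos (convex_Icc 0 T)
        (fun s hs => (hW s hs.1).continuousAt.continuousWithinAt)
        (fun s hs => (hW s (interior_subset hs).1).hasDerivWithinAt)
      intro s hs
      rw [interior_Icc] at hs
      have h := hle s hs.1.le (hlt s hs.1.le hs.2)
      nlinarith [Real.exp_pos (c * s)]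
    have h := hanti (Set.left_mem_Icc.2 hT) (Set.right_mem_Icc.2 hT) hT
    simp only [mul_zero, Real.exp_zero, mul_one] at h
    rw [neg_mul, Real.exp_neg, ← div_eq_mul_inv, le_div_iff₀ (Real.exp_pos _)]
    exact h
  refine key t ht fun s hs _ => ?_
  by_contra! hs'
  let S := Set.Ici (0 : ℝ) ∩ V ⁻¹' Set.Ici R
  have hSc : IsClosed S := hcont.preimage_isClosed_of_isClosed isClosed_Ici isClosed_Ici
  have hSb : BddBelow S := ⟨0, fun _ h => h.1⟩
  have hmem : sInf S ∈ S := hSc.csInf_mem ⟨s, hs, hs'⟩ hSb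
  have h := key (sInf S) hmem.1 fun r hr hrT => by
    by_contra! hr'
    exact hrT.not_ge (csInf_le hSb ⟨hr, hr'⟩)
  have hexp : Real.exp (-c * sInf S) ≤ 1 :=
    Real.exp_le_one_iff.2 (by nlinarith [hmem.1.out])
  have h' : R ≤ V (sInf S) := hmem.2
  nlinarith

/-- A symmetric bilinear form in two variables is controlled by the sum of its coefficients. -/
theorem bilinear_le_of_abs_le {k l m p q r s n η : ℝ} (hp : |p| ≤ n) (hq : |q| ≤ n)
    (hr : |r| ≤ η * n) (hs : |s| ≤ η * n) :
    (k * p + l * q) * r + (l * p + m * q) * s ≤ (|k| + 2 * |l| + |m|) * η * n ^ 2 := by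
  have hn : 0 ≤ n := (abs_nonneg p).trans hp
  have aux : ∀ {a b c : ℝ}, |b| ≤ n → |c| ≤ η * n → a * b * c ≤ |a| * η * n ^ 2 := by
    intro a b c hb hc
    calc a * b * c ≤ |a * b * c| := le_abs_self _
      _ = |a| * (|b| * |c|) := by rw [abs_mul, abs_mul, mul_assoc]
      _ ≤ |a| * (n * (η * n)) := by gcongr
      _ = |a| * η * n ^ 2 := by ring
  linarith [aux (a := k) hp hr, aux (a := l) hq hr, aux (a := l) hp hs, aux (a := m) hq hs]

theorem stmt16 (f : EuclideanSpace ℝ (Fin 2) → EuclideanSpace ℝ (Fin 2))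
    (hf : ContDiff ℝ 1 f)
    (x₀ : EuclideanSpace ℝ (Fin 2)) (hx₀ : f x₀ = 0)
    (A : Matrix (Fin 2) (Fin 2) ℝ)
    (hA : HasFDerivAt f (LinearMap.toContinuousLinearMap (Matrix.toEuclideanLin A)) x₀)
    (α : ℝ) (hα : 0 < α)
    (hspec : ∀ μ ∈ spectrum ℂ (A.map (algebraMap ℝ ℂ)), μ.re < -α)
    (ε : ℝ) (hε : 0 < ε) :
    ∃ δ : ℝ, 0 < δ ∧
      ∀ x : ℝ → EuclideanSpace ℝ (Fin 2),
        (∀ t : ℝ, 0 ≤ t → HasDerivAt x (f (x t)) t) →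
        ‖x 0 - x₀‖ < δ →
        ∀ t : ℝ, 0 ≤ t → ‖x t - x₀‖ ≤ ε * Real.exp (-α * t) := by
  obtain ⟨hτ, hΔ⟩ := trace_neg_and_det_pos_of_spectrum_re_lt A α hspec
  obtain ⟨a, ha⟩ : ∃ a, a = A 0 0 + α := ⟨_, rfl⟩
  obtain ⟨d, hd⟩ : ∃ d, d = A 1 1 + α := ⟨_, rfl⟩
  obtain ⟨b, hb⟩ : ∃ b, b = A 0 1 := ⟨_, rfl⟩
  obtain ⟨c, hc⟩ : ∃ c, c = A 1 0 := ⟨_, rfl⟩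
  rw [← ha, ← hd] at hτ
  rw [← ha, ← hd, ← hb, ← hc] at hΔ
  obtain ⟨D, hD⟩ : ∃ D, D = a * d - b * c := ⟨_, rfl⟩
  rw [← hD] at hΔ
  -- The Lyapunov form is `D + Cᵀ C`, where `C` is the adjugate of `A + α` and `D` its determinant.
  let k := D + d ^ 2 + c ^ 2
  let l := -(b * d + a * c)
  let m := D + b ^ 2 + a ^ 2
  let K := |k| + 2 * |l| + |m|
  have hK : 0 ≤ K := by positivity
  let η := -(a + d) * D / (K + 1)
  have hη : 0 < η := div_pos (mul_pos (neg_pos.2 hτ) hΔ) (by linarith)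
  have hKη : K * η ≤ -(a + d) * D := by
    have : (K + 1) * η = -(a + d) * D := mul_div_cancel₀ _ (by linarith)
    linarith
  obtain ⟨ρ, hρ, hball⟩ := Metric.eventually_nhds_iff.1 (hA.isLittleO.def hη)
  have hnorm : ∀ u : EuclideanSpace ℝ (Fin 2), ‖u‖ ^ 2 = u 0 ^ 2 + u 1 ^ 2 := fun u => by
    simp [EuclideanSpace.norm_sq_eq]
  have hcoord : ∀ (u : EuclideanSpace ℝ (Fin 2)) i, |u i| ≤ ‖u‖ := fun u i =>
    PiLp.norm_apply_le u i
  let Q : EuclideanSpace ℝ (Fin 2) → ℝ := fun u =>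
    k * u 0 ^ 2 + 2 * l * (u 0 * u 1) + m * u 1 ^ 2
  have hQlower : ∀ u, D * ‖u‖ ^ 2 ≤ Q u := fun u => by
    simp only [hnorm, Q, k, l, m]
    nlinarith [sq_nonneg (d * u 0 - b * u 1), sq_nonneg (c * u 0 - a * u 1)]
  have hQupper : ∀ u, Q u ≤ K * ‖u‖ ^ 2 := fun u => by
    have h := bilinear_le_of_abs_le (k := k) (l := l) (m := m) (hcoord u 0)
      (hcoord u 1) ((hcoord u 0).trans_eq (one_mul _).symm)
      ((hcoord u 1).trans_eq (one_mul _).symm)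
    calc Q u = _ := by simp only [Q]; ring
      _ ≤ _ := h
      _ = _ := by simp only [K]; ring
  let σ := min ρ ε
  have hσ : 0 < σ := lt_min hρ hε
  refine ⟨σ * √(D / (K + 1)), by positivity, fun x hx hx0 t ht => ?_⟩
  let V := fun t => Q (x t - x₀)
  have hV0 : V 0 < D * σ ^ 2 := by
    have hsq : ‖x 0 - x₀‖ ^ 2 < σ ^ 2 * (D / (K + 1)) := by
      have := pow_lt_pow_left₀ hx0 (norm_nonneg _) two_ne_zero
      rwa [mul_pow, Real.sq_sqrt (by positivity)] at this
    have hcancel : (K + 1) * (σ ^ 2 * (D / (K + 1))) = D * σ ^ 2 := by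
      field_simp
    calc V 0 ≤ K * ‖x 0 - x₀‖ ^ 2 := hQupper _
      _ ≤ (K + 1) * ‖x 0 - x₀‖ ^ 2 := by gcongr; linarith
      _ < (K + 1) * (σ ^ 2 * (D / (K + 1))) := by gcongr
      _ = _ := hcancel
  have hVnonneg : ∀ t, 0 ≤ V t := fun t => le_trans (by positivity) (hQlower _)
  have hderiv : ∀ t, 0 ≤ t → HasDerivAt V
      (2 * ((k * (x t - x₀) 0 + l * (x t - x₀) 1) * f (x t) 0 +
        (l * (x t - x₀) 0 + m * (x t - x₀) 1) * f (x t) 1)) t := by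
    intro t ht
    have hc : ∀ i, HasDerivAt (fun t => (x t - x₀) i) (f (x t) i) t := fun i =>
      (EuclideanSpace.proj (𝕜 := ℝ) i).hasFDerivAt.comp_hasDerivAt t ((hx t ht).sub_const x₀)
    refine (((((hc 0).pow 2).const_mul k).add (((hc 0).mul (hc 1)).const_mul (2 * l))).add
      (((hc 1).pow 2).const_mul m)).congr_deriv ?_
    simp
    ring
  have hdecay := le_mul_exp_of_hasDerivAt_le_below_level (c := 2 * α) (R := D * σ ^ 2)
    (by positivity) hderiv ?_ (hVnonneg 0) hV0 ht
  · have hsq : ‖x t - x₀‖ ^ 2 ≤ (σ * Real.exp (-α * t)) ^ 2 := by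
      have hexp : Real.exp (-(2 * α) * t) = Real.exp (-α * t) ^ 2 := by
        rw [← Real.exp_nat_mul]
        congr 1
        push_cast
        ring
      rw [hexp] at hdecay
      refine le_of_mul_le_mul_left ?_ hΔ
      calc D * ‖x t - x₀‖ ^ 2 ≤ V t := hQlower _
        _ ≤ V 0 * Real.exp (-α * t) ^ 2 := hdecay
        _ ≤ D * σ ^ 2 * Real.exp (-α * t) ^ 2 := by gcongr
        _ = D * (σ * Real.exp (-α * t)) ^ 2 := by ring
    calc ‖x t - x₀‖ ≤ σ * Real.exp (-α * t) := le_of_sq_le_sq hsq (by positivity)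
      _ ≤ ε * Real.exp (-α * t) := by gcongr; exact min_le_right _ _
  · intro s hs hsR
    have hlt : ‖x s - x₀‖ < ρ := by
      have : ‖x s - x₀‖ ^ 2 < σ ^ 2 :=
        lt_of_mul_lt_mul_left ((hQlower _).trans_lt hsR) hΔ.le
      exact (lt_of_pow_lt_pow_left₀ 2 hσ.le this).trans_le (min_le_left _ _)
    have hrem := hball (y := x s) (by rwa [dist_eq_norm])
    obtain ⟨u, hu⟩ : ∃ u, u = x s - x₀ := ⟨_, rfl⟩
    obtain ⟨r, hr⟩ : ∃ r, r = f (x s) - f x₀ - Matrix.toEuclideanLin A (x s - x₀) := ⟨_, rfl⟩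
    simp only [LinearMap.coe_toContinuousLinearMap'] at hrem
    rw [← hr, ← hu] at hrem
    have hf0 : f (x s) 0 = (a - α) * u 0 + b * u 1 + r 0 := by
      rw [hr, hx₀, ← hu, ha, hb]
      simp [Matrix.toLpLin_apply]
    have hf1 : f (x s) 1 = c * u 0 + (d - α) * u 1 + r 1 := by
      rw [hr, hx₀, ← hu, hd, hc]
      simp [Matrix.toLpLin_apply]
    have hbil := bilinear_le_of_abs_le (k := k) (l := l) (m := m) (hcoord u 0) (hcoord u 1)
      ((hcoord r 0).trans hrem) ((hcoord r 1).trans hrem)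
    have hKu : K * η * ‖u‖ ^ 2 ≤ -(a + d) * D * ‖u‖ ^ 2 := by gcongr
    have hlin : (k * u 0 + l * u 1) * ((a - α) * u 0 + b * u 1) +
        (l * u 0 + m * u 1) * (c * u 0 + (d - α) * u 1) =
        -α * Q u + (a + d) * D * ‖u‖ ^ 2 := by
      simp only [hnorm, Q, k, l, m, hD]
      ring
    simp only [V, ← hu, hf0, hf1]
    linarith
end

section
/- (Equilibrium inside a periodic orbit.) Let f : ℝ × ℝ → ℝ × ℝ be continuously differentiable and let γ : ℝ → ℝ × ℝ be a nonconstant periodic solution of x' = f(x) (so there is T > 0 with γ(t+T) = γ(t) for all t and γ is not constant). Then there exists a point x₀ ∉ range γ with f(x₀) = (0,0) such that the connected component of x₀ in the complement (range γ)ᶜ is a bounded set; that is, there is an equilibrium point in the bounded region delimited by the periodic orbit γ. -/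
open Filter Topology Metric Set
open scoped unitInterval

theorem exists_log_of_homotopy {X : Type*} [TopologicalSpace X] {H : I × X → ℂ}
    (hH : Continuous H) (hH0 : ∀ p, H p ≠ 0) {l : X → ℂ} (hl : Continuous l)
    (hlH : ∀ x, Complex.exp (l x) = H (0, x)) :
    ∃ L : I × X → ℂ, Continuous L ∧ (∀ p, Complex.exp (L p) = H p) ∧ ∀ x, L (0, x) = l x := by
  let H' : C(I × X, {z : ℂ // z ≠ 0}) := ⟨fun p ↦ ⟨H p, hH0 p⟩, hH.subtype_mk _⟩
  have h0 : ∀ x, H' (0, x) = ⟨Complex.exp (l x), Complex.exp_ne_zero _⟩ :=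
    fun x ↦ Subtype.ext (hlH x).symm
  refine ⟨Complex.isCoveringMap_exp.liftHomotopy H' ⟨l, hl⟩ h0, ContinuousMap.continuous _, ?_, ?_⟩
  · intro p
    exact congrArg Subtype.val
      (congrFun (Complex.isCoveringMap_exp.liftHomotopy_lifts H' ⟨l, hl⟩ h0) p)
  · exact Complex.isCoveringMap_exp.liftHomotopy_zero H' ⟨l, hl⟩ h0

theorem eq_of_forall_exp_eq {X : Type*} [TopologicalSpace X] [PreconnectedSpace X] {d : X → ℂ}
    (hd : Continuous d) {c : ℂ} (h : ∀ x, Complex.exp (d x) = c) (x y : X) : d x = d y :=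
  Complex.isCoveringMap_exp.const_of_comp hd (fun a b ↦ Subtype.ext ((h a).trans (h b).symm)) x y

/-- A weak form of Hopf's Umlaufsatz: the velocity of a simple closed regular curve has no periodic
continuous logarithm. The secant map `(z (s + h) - z s) / h` on the strip `0 ≤ h ≤ τ` (suitably
rescaled) is odd under the involution `(s, h) ↦ (s + h, τ - h)`, whose square is the translation
`s ↦ s + τ`; hence its logarithm cannot be periodic in `s`. -/
theorem not_exists_periodic_log_deriv {z z' : ℝ → ℂ} (hz : ∀ t, HasDerivAt z (z' t) t)
    (hz' : Continuous z') {τ : ℝ} (hτ : 0 < τ) (hper : ∀ t, z (t + τ) = z t)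
    (hinj : ∀ s t, z s = z t → ∃ n : ℤ, t - s = n * τ) :
    ¬ ∃ L : ℝ → ℂ, Continuous L ∧ (∀ t, L (t + τ) = L t) ∧ ∀ t, Complex.exp (L t) = z' t := by
  rintro ⟨L, hL, hLper, hLexp⟩
  have hz'per : ∀ t, z' (t + τ) = z' t := fun t ↦ by rw [← hLexp, hLper, hLexp]
  set D : ℝ → ℝ → ℂ := fun s h ↦ ∫ u in (0 : ℝ)..1, z' (s + u * h) with hD
  have hDcont : Continuous fun p : ℝ × ℝ ↦ D p.1 p.2 := by
    apply intervalIntegral.continuous_parametric_intervalIntegral_of_continuous'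
    fun_prop
  have hDmul : ∀ s h : ℝ, (h : ℂ) * D s h = z (s + h) - z s := by
    intro s h
    have := intervalIntegral.integral_eq_sub_of_hasDerivAt (a := 0) (b := 1)
      (f := fun u : ℝ ↦ z (s + u * h)) (f' := fun u ↦ h • z' (s + u * h)) ?_ ?_
    · simpa [intervalIntegral.integral_smul, hD] using this
    · intro u _
      exact HasDerivAt.scomp u (hz (s + u * h))
        ((((hasDerivAt_id u).mul_const h).const_add s).congr_deriv (by simp))
    · exact Continuous.intervalIntegrable (by fun_prop) _ _
  have hDper : ∀ s h, D (s + τ) h = D s h := by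
    intro s h
    simp only [hD]
    congr 1; ext u
    rw [← hz'per (s + u * h)]; ring_nf
  have hD0 : ∀ s, D s 0 = z' s := by intro s; simp [hD]
  have hDne : ∀ s h, 0 ≤ h → h < τ → D s h ≠ 0 := by
    intro s h h0 h1 hDz
    rcases h0.eq_or_lt with rfl | h0
    · rw [hD0, ← hLexp] at hDz
      exact Complex.exp_ne_zero _ hDz
    · have := hDmul s h
      rw [hDz, mul_zero, eq_comm, sub_eq_zero] at this
      obtain ⟨n, hn⟩ := hinj _ _ this.symm
      rw [add_sub_cancel_left] at hn
      have h2 : (0 : ℝ) < n := by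
        by_contra hc; push Not at hc; nlinarith
      have h3 : (n : ℝ) < 1 := by
        by_contra hc; push Not at hc; nlinarith
      norm_cast at h2 h3; omega
  set H : I × ℝ → ℂ := fun p ↦ if (p.1 : ℝ) ≤ 1 / 2 then D p.2 (τ * p.1)
    else - D (p.2 + τ * p.1) (τ * (1 - p.1)) with hHdef
  have hmid : ∀ s, D s (τ * (1 / 2)) = - D (s + τ * (1 / 2)) (τ * (1 / 2)) := by
    intro s
    have h1 := hDmul s (τ * (1 / 2))
    have h2 := hDmul (s + τ * (1 / 2)) (τ * (1 / 2))
    rw [show s + τ * (1 / 2) + τ * (1 / 2) = s + τ by ring, hper] at h2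
    have h3 : ((τ * (1 / 2) : ℝ) : ℂ) ≠ 0 := by
      rw [Complex.ofReal_ne_zero]; positivity
    apply mul_left_cancel₀ h3
    linear_combination h1 + h2
  have hH1 : ∀ (u : I) (s : ℝ), (u : ℝ) ≤ 1 / 2 → H (u, s) = D s (τ * u) :=
    fun u s hu ↦ if_pos hu
  have hH2 : ∀ (u : I) (s : ℝ), 1 / 2 ≤ (u : ℝ) → H (u, s) = - D (s + τ * u) (τ * (1 - u)) := by
    intro u s hu
    rcases hu.eq_or_lt with hu | hu
    · rw [hH1 _ _ hu.ge, ← hu, hmid]; norm_num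
    · exact if_neg hu.not_ge
  have hH : Continuous H := by
    refine Continuous.if_le ?_ ?_ (by fun_prop) continuous_const ?_
    · exact hDcont.comp (f := fun p : I × ℝ ↦ (p.2, τ * (p.1 : ℝ))) (by fun_prop)
    · exact (hDcont.comp (f := fun p : I × ℝ ↦ (p.2 + τ * p.1, τ * (1 - (p.1 : ℝ))))
        (by fun_prop)).neg
    · intro p hp
      rw [hp, hmid]; norm_num
  have hH0 : ∀ p, H p ≠ 0 := by
    intro p
    have := p.1.2.1
    have := p.1.2.2
    simp only [hHdef]
    split_ifs with hp
    · exact hDne _ _ (by positivity) (by nlinarith)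
    · push Not at hp
      exact neg_ne_zero.mpr (hDne _ _ (mul_nonneg hτ.le (by linarith)) (by nlinarith))
  obtain ⟨Λ, hΛ, hΛexp, hΛ0⟩ := exists_log_of_homotopy hH hH0 hL (by
    intro s; simp [hHdef, hD0, hLexp])
  have hHper : ∀ u s, H (u, s + τ) = H (u, s) := by
    intro u s
    simp only [hHdef, hDper]
    rw [show s + τ + τ * u = s + τ * u + τ by ring, hDper]
  have hHneg : ∀ u s, H (σ u, s + τ * u) = - H (u, s) := by
    intro u s
    rcases le_total (u : ℝ) (1 / 2) with hu | hu
    · rw [hH2 _ _ (by rw [unitInterval.coe_symm_eq]; linarith), hH1 _ _ hu,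
        unitInterval.coe_symm_eq, show s + τ * u + τ * (1 - u) = s + τ by ring, hDper, sub_sub_cancel]
    · rw [hH1 _ _ (by rw [unitInterval.coe_symm_eq]; linarith), hH2 _ _ hu, neg_neg,
        unitInterval.coe_symm_eq]
  have hΛper : ∀ u s, Λ (u, s + τ) = Λ (u, s) := by
    intro u s
    have := eq_of_forall_exp_eq (X := I × ℝ) (d := fun p ↦ Λ (p.1, p.2 + τ) - Λ p)
      (by fun_prop) (c := 1) (fun p ↦ by
        rw [Complex.exp_sub, hΛexp, hΛexp, hHper, div_self (hH0 _)]) (u, s) (0, s)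
    simp only [hΛ0, hLper, sub_self] at this
    exact sub_eq_zero.mp this
  set d : I × ℝ → ℂ := fun p ↦ Λ (σ p.1, p.2 + τ * p.1) - Λ p with hd
  have hdexp : ∀ p, Complex.exp (d p) = -1 := fun p ↦ by
    rw [hd, Complex.exp_sub, hΛexp, hΛexp, hHneg, neg_div, div_self (hH0 _)]
  have hd0 : d (0, 0) + d (1, 0) = 0 := by
    have := hΛper 0 0
    simp [hd] at this ⊢
    rw [this]; ring
  have hdc : d (0, 0) = d (1, 0) := eq_of_forall_exp_eq (by fun_prop) hdexp _ _
  have := hdexp (0, 0)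
  rw [show d (0, 0) = 0 by linear_combination hd0 / 2 + hdc / 2, Complex.exp_zero] at this
  norm_num at this

/-- `g` admits a continuous logarithm on `K`. -/
def HasContinuousLogOn (g : ℂ → ℂ) (K : Set ℂ) : Prop :=
  ∃ l : ℂ → ℂ, ContinuousOn l K ∧ ∀ z ∈ K, Complex.exp (l z) = g z

namespace HasContinuousLogOn

variable {g h : ℂ → ℂ} {K : Set ℂ}

theorem congr (hg : HasContinuousLogOn g K) (hgh : ∀ z ∈ K, g z = h z) :
    HasContinuousLogOn h K := by
  obtain ⟨l, hl, hle⟩ := hg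
  exact ⟨l, hl, fun z hz ↦ (hle z hz).trans (hgh z hz)⟩

theorem mul (hg : HasContinuousLogOn g K) (hh : HasContinuousLogOn h K) :
    HasContinuousLogOn (fun z ↦ g z * h z) K := by
  obtain ⟨l, hl, hle⟩ := hg
  obtain ⟨m, hm, hme⟩ := hh
  exact ⟨fun z ↦ l z + m z, hl.add hm, fun z hz ↦ by rw [Complex.exp_add, hle z hz, hme z hz]⟩

theorem inv (hg : HasContinuousLogOn g K) : HasContinuousLogOn (fun z ↦ (g z)⁻¹) K := by
  obtain ⟨l, hl, hle⟩ := hg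
  exact ⟨fun z ↦ -l z, hl.neg, fun z hz ↦ by rw [Complex.exp_neg, hle z hz]⟩

theorem conj (hg : HasContinuousLogOn g K) :
    HasContinuousLogOn (fun z ↦ starRingEnd ℂ (g z)) K := by
  obtain ⟨l, hl, hle⟩ := hg
  exact ⟨fun z ↦ starRingEnd ℂ (l z), Complex.continuous_conj.comp_continuousOn hl,
    fun z hz ↦ by rw [Complex.exp_conj, hle z hz]⟩

theorem const {c : ℂ} (hc : c ≠ 0) : HasContinuousLogOn (fun _ ↦ c) K :=
  ⟨fun _ ↦ Complex.log c, continuousOn_const, fun _ _ ↦ Complex.exp_log hc⟩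

theorem of_norm_sub_one_lt (hg : ContinuousOn g K) (h1 : ∀ z ∈ K, ‖g z - 1‖ < 1) :
    HasContinuousLogOn g K := by
  have hs : ∀ z ∈ K, g z ∈ Complex.slitPlane := fun z hz ↦ by
    simpa using Complex.mem_slitPlane_of_norm_lt_one (h1 z hz)
  exact ⟨fun z ↦ Complex.log (g z), hg.clog hs,
    fun z hz ↦ Complex.exp_log (Complex.slitPlane_ne_zero (hs z hz))⟩

theorem of_homotopy {H : I → ℂ → ℂ}
    (hH : ContinuousOn (Function.uncurry H) (univ ×ˢ K)) (hH0 : ∀ t, ∀ z ∈ K, H t z ≠ 0)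
    (h : HasContinuousLogOn (H 0) K) : HasContinuousLogOn (H 1) K := by
  obtain ⟨l, hl, hle⟩ := h
  obtain ⟨L, hL, hLe, -⟩ := exists_log_of_homotopy (X := K) (H := fun p ↦ H p.1 p.2)
    (hH.comp_continuous (f := fun p : I × K ↦ (p.1, (p.2 : ℂ))) (by fun_prop) (by simp))
    (fun p ↦ hH0 _ _ p.2.2) (continuousOn_iff_continuous_domRestrict.mp hl) (fun x ↦ hle _ x.2)
  refine ⟨Function.extend Subtype.val (fun x ↦ L (1, x)) 0, ?_, ?_⟩
  · rw [continuousOn_iff_continuous_domRestrict]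
    have : K.domRestrict (Function.extend Subtype.val (fun x ↦ L (1, x)) 0) = fun x ↦ L (1, x) := by
      ext x
      exact Subtype.val_injective.extend_apply (fun x ↦ L (1, x)) 0 x
    rw [this]
    fun_prop
  · intro z hz
    rw [Subtype.val_injective.extend_apply _ _ (⟨z, hz⟩ : K), hLe]

theorem of_subset_ball {R : ℝ} (hK : K ⊆ ball 0 R) (hg : ContinuousOn g (ball 0 R))
    (hg0 : ∀ z ∈ ball 0 R, g z ≠ 0) : HasContinuousLogOn g K := by
  rcases K.eq_empty_or_nonempty with rfl | ⟨w, hw⟩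
  · exact ⟨g, continuousOn_empty _, by simp⟩
  have hR : 0 < R := pos_of_mem_ball (hK hw)
  have hmem : ∀ t : I, ∀ z ∈ K, (t : ℂ) * z ∈ ball (0 : ℂ) R := by
    intro t z hz
    have := hK hz
    rw [mem_ball_zero_iff] at this ⊢
    rw [norm_mul, Complex.norm_real, Real.norm_of_nonneg t.2.1]
    exact (mul_le_of_le_one_left (norm_nonneg _) t.2.2).trans_lt this
  have := of_homotopy (K := K) (H := fun t z ↦ g ((t : ℂ) * z)) ?_
    (fun t z hz ↦ hg0 _ (hmem t z hz)) ?_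
  · exact this.congr (by simp)
  · exact hg.comp (f := fun p : I × ℂ ↦ ((p.1 : ℝ) : ℂ) * p.2) (by fun_prop)
      fun p hp ↦ hmem _ _ hp.2
  · exact (const (hg0 0 (by simpa))).congr (by simp)

theorem sub_const (hK : IsCompact K) (hKc : IsPreconnected Kᶜ) {a : ℂ} (ha : a ∉ K) :
    HasContinuousLogOn (fun z ↦ z - a) K := by
  obtain ⟨R, hR⟩ := hK.isBounded.subset_ball_lt 0 0
  have hp : ∀ z ∈ K, ‖z‖ < R := fun z hz ↦ by simpa using hR.2 hz
  have hRn : ‖(R : ℂ)‖ = R := by rw [Complex.norm_real, Real.norm_of_nonneg hR.1.le]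
  have hR0 : (R : ℂ) ≠ 0 := by exact_mod_cast hR.1.ne'
  have hRK : (R : ℂ) ∈ Kᶜ := fun h ↦ (hp _ h).ne hRn
  have hpath : IsPathConnected Kᶜ :=
    hK.isClosed.isOpen_compl.isConnected_iff_isPathConnected.mp ⟨⟨a, ha⟩, hKc⟩
  obtain ⟨p, hpK⟩ := hpath.joinedIn _ hRK _ ha
  have := of_homotopy (K := K) (H := fun t z ↦ z - p t) (by fun_prop) ?_ ?_
  · simpa using this
  · intro t z hz h
    exact hpK t (sub_eq_zero.mp h ▸ hz)
  · have h1 : HasContinuousLogOn (fun z ↦ 1 - z / R) K := by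
      apply of_norm_sub_one_lt (by fun_prop)
      intro z hz
      rw [sub_sub_cancel_left, norm_neg, norm_div, hRn, div_lt_one hR.1]
      exact hp z hz
    refine (h1.mul (const (neg_ne_zero.mpr hR0))).congr fun z hz ↦ ?_
    rw [p.source]
    field_simp
    ring

end HasContinuousLogOn

/-- `q` is `z - a` or its conjugate. -/
def IsLinearFactor (q : ℂ → ℂ) (a : ℂ) : Prop :=
  q = (fun z ↦ z - a) ∨ q = fun z ↦ starRingEnd ℂ (z - a)

theorem IsLinearFactor.continuous {q : ℂ → ℂ} {a : ℂ} (hq : IsLinearFactor q a) :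
    Continuous q := by
  rcases hq with rfl | rfl
  · fun_prop
  · exact Complex.continuous_conj.comp (by fun_prop)

theorem IsLinearFactor.ne_zero {q : ℂ → ℂ} {a : ℂ} (hq : IsLinearFactor q a) {z : ℂ}
    (hz : z ≠ a) : q z ≠ 0 := by
  rcases hq with rfl | rfl
  · exact sub_ne_zero.mpr hz
  · exact (map_ne_zero _).mpr (sub_ne_zero.mpr hz)

/-- Near `a`, the function `h` equals `z - a` or its conjugate up to a factor which has a continuous
logarithm on a punctured neighbourhood of `a`. -/
def IsSimpleZeroAt (h : ℂ → ℂ) (a : ℂ) : Prop :=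
  ∃ l q : ℂ → ℂ, IsLinearFactor q a ∧
    ∀ᶠ z in 𝓝[≠] a, ContinuousAt l z ∧ h z = Complex.exp (l z) * q z

theorem IsSimpleZeroAt.eventually_ne {h : ℂ → ℂ} {a : ℂ} (ha : IsSimpleZeroAt h a) :
    ∀ᶠ z in 𝓝[≠] a, h z ≠ 0 := by
  obtain ⟨l, q, hq, h1⟩ := ha
  filter_upwards [h1, self_mem_nhdsWithin] with z hz hza
  rw [hz.2]
  exact mul_ne_zero (Complex.exp_ne_zero _) (hq.ne_zero hza)

theorem IsSimpleZeroAt.of_eventually_eq_div {h h' k : ℂ → ℂ} {a : ℂ} (ha : IsSimpleZeroAt h a)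
    (hk : Continuous k) (hk0 : k a ≠ 0) (hh' : ∀ᶠ z in 𝓝 a, h' z = h z / k z) :
    IsSimpleZeroAt h' a := by
  obtain ⟨l, q, hq, h1⟩ := ha
  refine ⟨fun z ↦ l z - (Complex.log (k a) + Complex.log (k z / k a)), q, hq, ?_⟩
  have hs : ∀ᶠ z in 𝓝 a, k z / k a ∈ Complex.slitPlane := by
    apply (hk.div_const (k a)).continuousAt.eventually_mem
    apply Complex.isOpen_slitPlane.mem_nhds
    rw [div_self hk0]
    exact Complex.one_mem_slitPlane
  filter_upwards [h1, hh'.filter_mono nhdsWithin_le_nhds, hs.filter_mono nhdsWithin_le_nhds]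
    with z h1 h2 h3
  refine ⟨h1.1.sub (continuousAt_const.add ((hk.div_const _).continuousAt.clog h3)), ?_⟩
  have : k z ≠ 0 := fun h ↦ by simp [h] at h3
  rw [h2, h1.2, Complex.exp_sub, Complex.exp_add, Complex.exp_log hk0,
    Complex.exp_log (Complex.slitPlane_ne_zero h3)]
  field_simp

theorem isSimpleZeroAt_of_norm_sub_lt {h q : ℂ → ℂ} {a κ : ℂ} (hκ : κ ≠ 0)
    (hh : Continuous h)
    (hq : IsLinearFactor q a)
    (hlt : ∀ᶠ z in 𝓝[≠] a, ‖h z - κ * q z‖ < ‖κ * q z‖) : IsSimpleZeroAt h a := by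
  refine ⟨fun z ↦ Complex.log κ + Complex.log (h z / (κ * q z)), q, hq, ?_⟩
  have hqc : Continuous q := hq.continuous
  filter_upwards [hlt] with z hz
  have h0 : κ * q z ≠ 0 := norm_pos_iff.mp ((norm_nonneg _).trans_lt hz)
  have hs : h z / (κ * q z) ∈ Complex.slitPlane := by
    have : ‖h z / (κ * q z) - 1‖ < 1 := by
      rw [div_sub_one h0, norm_div, div_lt_one (norm_pos_iff.mpr h0)]
      exact hz
    simpa using Complex.mem_slitPlane_of_norm_lt_one this
  refine ⟨continuousAt_const.add (ContinuousAt.clog (f := fun z ↦ h z / (κ * q z))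
    (hh.continuousAt.div (by fun_prop) h0) hs), ?_⟩
  rw [Complex.exp_add, Complex.exp_log hκ, Complex.exp_log (Complex.slitPlane_ne_zero hs)]
  field_simp [right_ne_zero_of_mul h0]

theorem ContinuousLinearMap.exists_eq_mul_add_mul_conj (D : ℂ →L[ℝ] ℂ) :
    ∃ α β : ℂ, ∀ w, D w = α * w + β * starRingEnd ℂ w := by
  refine ⟨(D 1 - Complex.I * D Complex.I) / 2, (D 1 + Complex.I * D Complex.I) / 2, fun w ↦ ?_⟩
  have h1 : w = w.re • (1 : ℂ) + w.im • Complex.I := by simp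
  have h2 : starRingEnd ℂ w = w.re - w.im * Complex.I := by
    apply Complex.ext <;> simp
  conv_lhs => rw [h1, map_add, map_smul, map_smul]
  conv_rhs => rw [h2]; enter [1, 2]; rw [← Complex.re_add_im w]
  simp only [Complex.real_smul]
  linear_combination (w.im * D Complex.I) * Complex.I_sq

theorem exists_ne_zero_mul_add_mul_conj_eq_zero {α β : ℂ} (h : ‖α‖ = ‖β‖) :
    ∃ w : ℂ, w ≠ 0 ∧ α * w + β * starRingEnd ℂ w = 0 := by
  rcases eq_or_ne α 0 with rfl | hα
  · have : β = 0 := by simpa using h.symm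
    exact ⟨1, one_ne_zero, by simp [this]⟩
  obtain ⟨w, hw⟩ := IsAlgClosed.exists_pow_nat_eq (- β / α) (n := 2) (by norm_num)
  have hn : ‖w‖ = 1 := by
    have := congrArg norm hw
    rw [norm_pow, norm_div, norm_neg, ← h, div_self (norm_ne_zero_iff.mpr hα)] at this
    exact (pow_eq_one_iff_of_nonneg (norm_nonneg _) two_ne_zero).mp this
  have hw0 : w ≠ 0 := by rw [← norm_ne_zero_iff, hn]; exact one_ne_zero
  refine ⟨w, hw0, ?_⟩
  have h1 : w * starRingEnd ℂ w = 1 := by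
    rw [Complex.mul_conj, Complex.normSq_eq_norm_sq, hn]; norm_num
  apply mul_left_cancel₀ hw0
  rw [eq_div_iff hα] at hw
  linear_combination hw + β * h1

theorem HasFDerivAt.isSimpleZeroAt {h : ℂ → ℂ} {D : ℂ →L[ℝ] ℂ} {a : ℂ} (hD : HasFDerivAt h D a)
    (hh : Continuous h) (ha : h a = 0) (hdet : D.det ≠ 0) : IsSimpleZeroAt h a := by
  obtain ⟨α, β, hαβ⟩ := D.exists_eq_mul_add_mul_conj
  have hne : ‖α‖ ≠ ‖β‖ := by
    intro heq
    obtain ⟨w, hw0, hw⟩ := exists_ne_zero_mul_add_mul_conj_eq_zero heq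
    refine hw0 ((D.toContinuousLinearEquivOfDetNeZero hdet).injective ?_)
    simpa [hαβ] using hw
  have key : ∀ κ μ : ℂ, ∀ q q' : ℂ → ℂ,
      IsLinearFactor q a →
      (∀ z, ‖q z‖ = ‖z - a‖) → (∀ z, ‖q' z‖ = ‖z - a‖) →
      (∀ z, D (z - a) = κ * q z + μ * q' z) → ‖μ‖ < ‖κ‖ → IsSimpleZeroAt h a := by
    intro κ μ q q' hq hqn hqn' hDq hlt
    refine isSimpleZeroAt_of_norm_sub_lt (κ := κ)
      (norm_pos_iff.mp ((norm_nonneg _).trans_lt hlt)) hh hq ?_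
    have hε : 0 < (‖κ‖ - ‖μ‖) / 2 := by linarith
    filter_upwards [(hD.isLittleO.def hε).filter_mono nhdsWithin_le_nhds, self_mem_nhdsWithin]
      with z hz hza
    have hpos : 0 < ‖z - a‖ := norm_pos_iff.mpr (sub_ne_zero.mpr hza)
    rw [ha, sub_zero] at hz
    calc ‖h z - κ * q z‖ = ‖(h z - D (z - a)) + μ * q' z‖ := by rw [hDq]; ring_nf
      _ ≤ (‖κ‖ - ‖μ‖) / 2 * ‖z - a‖ + ‖μ‖ * ‖z - a‖ := by
        grw [norm_add_le, hz, norm_mul, hqn']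
      _ < ‖κ * q z‖ := by
        rw [norm_mul, hqn]
        nlinarith
  rcases hne.lt_or_gt with hlt | hlt
  · exact key β α (fun z ↦ starRingEnd ℂ (z - a)) (fun z ↦ z - a) (.inr rfl)
      (fun z ↦ Complex.norm_conj _) (fun _ ↦ rfl) (fun z ↦ by rw [hαβ, add_comm]) hlt
  · exact key α β (fun z ↦ z - a) (fun z ↦ starRingEnd ℂ (z - a)) (.inl rfl)
      (fun _ ↦ rfl) (fun z ↦ Complex.norm_conj _) (fun z ↦ hαβ _) hlt

/-- Dividing out a simple zero: near `a` the quotient `h / q` is `exp l`, and multiplying by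
`exp ((χ - 1) l)` with a cutoff `χ` extends it continuously across `a`. -/
theorem IsSimpleZeroAt.exists_removed {h : ℂ → ℂ} {a : ℂ} (ha : IsSimpleZeroAt h a)
    {Ω N : Set ℂ} (hΩ : ContinuousOn h Ω) (hN : N ∈ 𝓝 a) :
    ∃ h' q : ℂ → ℂ, IsLinearFactor q a ∧
      ContinuousOn h' Ω ∧ h' a ≠ 0 ∧ (∀ z, z ≠ a → h' z = 0 → h z = 0) ∧
      ∃ M ⊆ N, IsClosed M ∧ ∀ z ∉ M, h' z = h z / q z := by
  obtain ⟨l, q, hq, hl⟩ := ha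
  have hqc : Continuous q := hq.continuous
  have hq0 : ∀ z, z ≠ a → q z ≠ 0 := fun z hz ↦ hq.ne_zero hz
  obtain ⟨r', hr', hball⟩ := Metric.mem_nhds_iff.mp
    (inter_mem hN (eventually_nhdsWithin_iff.mp hl))
  obtain ⟨r, hr, hrr'⟩ := exists_between hr'
  set χ : ℂ → ℝ := fun z ↦ max 0 (min 1 (2 * dist z a / r - 1)) with hχ
  have hχc : Continuous χ := by fun_prop
  have hχ1 : ∀ z, r ≤ dist z a → χ z = 1 := by
    intro z hz
    have : 1 ≤ 2 * dist z a / r - 1 := by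
      rw [le_sub_iff_add_le, le_div_iff₀ hr]; linarith
    simp [hχ, this]
  have hχ0 : ∀ z, dist z a ≤ r / 2 → χ z = 0 := by
    intro z hz
    have : 2 * dist z a / r - 1 ≤ 0 := by
      rw [sub_nonpos, div_le_one hr]; linarith
    simp [hχ, this]
  set m : ℂ → ℂ := fun z ↦ Complex.exp ((χ z - 1) * l z) * (h z / q z) with hm
  have hmne : ∀ z, z ≠ a → Function.update m a 1 z = m z := fun z hz ↦ Function.update_of_ne hz _ _
  refine ⟨Function.update m a 1, q, hq, ?_, by simp, ?_, closedBall a r,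
    fun z hz ↦ (hball (closedBall_subset_ball hrr' hz)).1, isClosed_closedBall, ?_⟩
  · intro z hz
    rcases eq_or_ne z a with rfl | hza
    · refine ContinuousAt.continuousWithinAt ?_
      refine (continuousAt_const (y := (1 : ℂ))).congr ?_
      filter_upwards [ball_mem_nhds z (half_pos hr)] with w hw
      rcases eq_or_ne w z with rfl | hwz
      · simp
      · rw [hmne w hwz, hm]
        have hw' := (hball (ball_subset_ball (by linarith) hw)).2 hwz
        simp only
        rw [hχ0 w (mem_ball.mp hw).le, hw'.2, mul_div_cancel_right₀ _ (hq0 w hwz),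
          ← Complex.exp_add]
        simp
    · have hcongr : m =ᶠ[𝓝 z] Function.update m a 1 := by
        filter_upwards [isOpen_ne.mem_nhds hza] with w hw using (hmne w hw).symm
      refine ContinuousWithinAt.congr_of_eventuallyEq ?_
        (hcongr.symm.filter_mono nhdsWithin_le_nhds) (hmne z hza)
      refine ContinuousWithinAt.mul (ContinuousAt.continuousWithinAt ?_)
        ((hΩ z hz).div hqc.continuousWithinAt (hq0 z hza))
      refine Complex.continuous_exp.continuousAt.comp ?_
      rcases lt_or_ge (dist z a) r' with hzr | hzr
      · exact ContinuousAt.mul (by fun_prop) ((hball hzr).2 hza).1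
      · refine (continuousAt_const (y := (0 : ℂ))).congr ?_
        have : ∀ᶠ w in 𝓝 z, r < dist w a :=
          (by fun_prop : Continuous fun w ↦ dist w a).continuousAt.eventually_const_lt
            (hrr'.trans_le hzr)
        filter_upwards [this] with w hw
        simp [hχ1 w hw.le]
  · intro z hza hz
    rw [hmne z hza, hm] at hz
    simpa [Complex.exp_ne_zero, hq0 z hza] using hz
  · intro z hz
    rw [mem_closedBall, not_le] at hz
    have hza : z ≠ a := by
      rintro rfl
      rw [dist_self] at hz
      exact absurd hz hr.not_gt
    rw [hmne z hza, hm]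
    simp [hχ1 z hz.le]

theorem hasContinuousLogOn_of_isSimpleZeroAt {K : Set ℂ} (hK : IsCompact K)
    (hKc : IsPreconnected Kᶜ) {R : ℝ} (hKR : K ⊆ ball 0 R) (Z : Finset ℂ) :
    ∀ h : ℂ → ℂ, ContinuousOn h (ball 0 R) → (∀ z ∈ ball 0 R, h z = 0 → z ∈ Z) →
      (∀ a ∈ Z, a ∉ K ∧ IsSimpleZeroAt h a) → HasContinuousLogOn h K := by
  induction Z using Finset.induction_on with
  | empty => exact fun h hc h0 _ ↦ .of_subset_ball hKR hc fun z hz hz0 ↦ by simpa using h0 z hz hz0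
  | insert a Z haZ ih =>
    intro h hc h0 hs
    obtain ⟨haK, ha⟩ := hs a (Finset.mem_insert_self a Z)
    have hN : (K ∪ (Z : Set ℂ))ᶜ ∈ 𝓝 a :=
      (hK.isClosed.union Z.finite_toSet.isClosed).isOpen_compl.mem_nhds (by simp [haK, haZ])
    obtain ⟨h', q, hq, hc', ha', h0', M, hMN, hM, hMq⟩ := ha.exists_removed hc hN
    have hqc : Continuous q := hq.continuous
    have hq0 : ∀ z, z ≠ a → q z ≠ 0 := fun z hz ↦ hq.ne_zero hz
    have hqK : HasContinuousLogOn q K := by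
      rcases hq with rfl | rfl
      · exact .sub_const hK hKc haK
      · exact (HasContinuousLogOn.sub_const hK hKc haK).conj
    have key := ih h' hc' ?_ ?_
    · refine (key.mul hqK).congr fun z hz ↦ ?_
      rw [hMq z fun hzM ↦ hMN hzM (.inl hz), div_mul_cancel₀]
      exact hq0 z (ne_of_mem_of_not_mem hz haK)
    · intro z hz hz0
      have hza : z ≠ a := fun h ↦ ha' (h ▸ hz0)
      exact (Finset.mem_insert.mp (h0 z hz (h0' z hza hz0))).resolve_left hza
    · intro b hb
      obtain ⟨hbK, hbs⟩ := hs b (Finset.mem_insert_of_mem hb)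
      refine ⟨hbK, hbs.of_eventually_eq_div hqc (hq0 b (ne_of_mem_of_not_mem hb haZ)) ?_⟩
      filter_upwards [hM.isOpen_compl.mem_nhds fun hbM ↦ hMN hbM (.inr hb)] with z hz
        using hMq z hz

/-- **Borsuk's theorem** for `C¹` maps: a nonvanishing map on a compact set which does not separate
the plane has a continuous logarithm. -/
theorem ContDiff.hasContinuousLogOn {g : ℂ → ℂ} (hg : ContDiff ℝ 1 g) {K : Set ℂ}
    (hK : IsCompact K) (hKc : IsPreconnected Kᶜ) (hg0 : ∀ z ∈ K, g z ≠ 0) :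
    HasContinuousLogOn g K := by
  rcases K.eq_empty_or_nonempty with rfl | hKne
  · exact ⟨g, continuousOn_empty _, by simp⟩
  have hgd : ∀ z, HasFDerivAt g (fderiv ℝ g z) z :=
    fun z ↦ (hg.differentiable one_ne_zero z).hasFDerivAt
  obtain ⟨w, hw, hwmin⟩ := hK.exists_isMinOn hKne hg.continuous.norm.continuousOn
  have hpos : 0 < ‖g w‖ := norm_pos_iff.mpr (hg0 w hw)
  obtain ⟨c, hcball, hc⟩ : ∃ c ∈ ball (0 : ℂ) ‖g w‖, c ∉ g '' {z | (fderiv ℝ g z).det = 0} := by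
    have h0 := MeasureTheory.addHaar_image_eq_zero_of_det_fderivWithin_eq_zero
      (MeasureTheory.volume : MeasureTheory.Measure ℂ)
      (s := {z | (fderiv ℝ g z).det = 0}) (f := g) (fun z _ ↦ (hgd z).hasFDerivWithinAt)
      (fun z hz ↦ hz)
    by_contra! hcon
    exact (measure_ball_pos MeasureTheory.volume (0 : ℂ) hpos).ne'
      (MeasureTheory.measure_mono_null hcon h0)
  rw [mem_ball_zero_iff] at hcball
  have hcK : ∀ z ∈ K, ‖c‖ < ‖g z‖ := fun z hz ↦ hcball.trans_le (hwmin hz)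
  set h : ℂ → ℂ := fun z ↦ g z - c with hh
  have hhc : Continuous h := hg.continuous.sub continuous_const
  have hsimple : ∀ a, h a = 0 → IsSimpleZeroAt h a := fun a ha ↦
    ((hgd a).sub_const c).isSimpleZeroAt hhc ha fun hdet ↦ hc ⟨a, hdet, sub_eq_zero.mp ha⟩
  have hhK : ∀ z ∈ K, h z ≠ 0 := fun z hz hz0 ↦ (hcK z hz).ne' (by rw [sub_eq_zero.mp hz0])
  obtain ⟨R, hKR⟩ := hK.isBounded.subset_ball 0
  have hfin : (closedBall (0 : ℂ) R ∩ {z | h z = 0}).Finite := by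
    by_contra hinf
    obtain ⟨a, -, ha⟩ := Set.Infinite.exists_accPt_of_subset_isCompact hinf
      (isCompact_closedBall (0 : ℂ) R) inter_subset_left
    have hclosed : IsClosed {z | h z = 0} := isClosed_eq hhc continuous_const
    have hfreq := accPt_iff_frequently_nhdsNE.mp ha
    have ha0 : h a = 0 := by
      have : a ∈ closure {z | h z = 0} := mem_closure_iff_frequently.mpr
        ((hfreq.filter_mono nhdsWithin_le_nhds).mono fun z hz ↦ hz.2)
      rwa [hclosed.closure_eq] at this
    exact hfreq ((hsimple a ha0).eventually_ne.mono fun z hz hz' ↦ hz hz'.2)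
  have hlog : HasContinuousLogOn h K := by
    refine hasContinuousLogOn_of_isSimpleZeroAt hK hKc hKR hfin.toFinset h hhc.continuousOn ?_ ?_
    · intro z hz hz0
      simpa using ⟨by simpa using (mem_ball.mp hz).le, hz0⟩
    · intro a ha
      have ha0 : h a = 0 := ((hfin.mem_toFinset).mp ha).2
      exact ⟨fun haK ↦ hhK a haK ha0, hsimple a ha0⟩
  have hquot : HasContinuousLogOn (fun z ↦ h z / g z) K := by
    apply HasContinuousLogOn.of_norm_sub_one_lt
      (hhc.continuousOn.div hg.continuous.continuousOn hg0)
    intro z hz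
    change ‖h z / g z - 1‖ < 1
    rw [div_sub_one (hg0 z hz), norm_div, div_lt_one (norm_pos_iff.mpr (hg0 z hz)),
      sub_sub_cancel_left, norm_neg]
    exact hcK z hz
  refine (hlog.mul hquot.inv).congr fun z hz ↦ ?_
  rw [inv_div, mul_div_cancel₀ _ (hhK z hz)]

theorem Complex.isPreconnected_setOf_le_norm {R : ℝ} (hR : 0 < R) :
    IsPreconnected {w : ℂ | R ≤ ‖w‖} := by
  have : {w : ℂ | R ≤ ‖w‖} = Complex.exp '' {w | Real.log R ≤ w.re} := by
    ext w
    simp only [mem_ofPred_eq, mem_image]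
    constructor
    · intro hw
      have hw0 : w ≠ 0 := norm_pos_iff.mp (hR.trans_le hw)
      exact ⟨Complex.log w, by rw [Complex.log_re]; exact Real.log_le_log hR hw,
        Complex.exp_log hw0⟩
    · rintro ⟨v, hv, rfl⟩
      rw [Complex.norm_exp]
      exact (Real.log_le_iff_le_exp hR).mp hv
  rw [this]
  exact (convex_halfSpace_re_ge _).isPreconnected.image _ Complex.continuous_exp.continuousOn

/-- The union of a compact subset of the plane and the bounded components of its complement. -/
theorem exists_isCompact_superset_isPreconnected_compl {C : Set ℂ} (hC : IsCompact C) :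
    ∃ K, IsCompact K ∧ C ⊆ K ∧ IsPreconnected Kᶜ ∧
      ∀ w ∈ K \ C, Bornology.IsBounded (connectedComponentIn Cᶜ w) := by
  obtain ⟨R, hR, hCR⟩ := hC.isBounded.subset_ball_lt 0 0
  have hout : {w : ℂ | R ≤ ‖w‖} ⊆ Cᶜ := fun w hw hwC ↦ by
    have := hCR hwC
    rw [mem_ball_zero_iff] at this
    exact this.not_ge hw
  have hRmem : (R : ℂ) ∈ {w : ℂ | R ≤ ‖w‖} := by
    rw [mem_ofPred_eq, Complex.norm_real]; exact le_abs_self R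
  set U := connectedComponentIn Cᶜ (R : ℂ) with hU
  have hUsub : {w : ℂ | R ≤ ‖w‖} ⊆ U :=
    (Complex.isPreconnected_setOf_le_norm hR).subset_connectedComponentIn hRmem hout
  have hKR : Uᶜ ⊆ ball 0 R := fun w hw ↦ by
    rw [mem_ball_zero_iff]
    by_contra! h
    exact hw (hUsub h)
  refine ⟨Uᶜ, ?_, ?_, ?_, ?_⟩
  · exact Metric.isCompact_of_isClosed_isBounded
      (hC.isClosed.isOpen_compl.connectedComponentIn).isClosed_compl (isBounded_ball.subset hKR)
  · exact subset_compl_comm.mp (connectedComponentIn_subset _ _)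
  · rw [compl_compl]
    exact isPreconnected_connectedComponentIn
  · rintro w ⟨hwU, hwC⟩
    have hsub : connectedComponentIn Cᶜ w ⊆ Uᶜ := by
      intro v hv hvU
      apply hwU
      rw [hU, connectedComponentIn_eq hvU, ← connectedComponentIn_eq hv]
      exact mem_connectedComponentIn hwC
    exact isBounded_ball.subset (hsub.trans hKR)

/-- A nonconstant continuous periodic function on `ℝ` has a minimal positive period. -/
theorem Function.Periodic.exists_minimal_period {α : Type*} [TopologicalSpace α] [T2Space α]
    {z : ℝ → α} (hz : Continuous z) {T : ℝ} (hT : 0 < T) (hper : Function.Periodic z T)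
    (hnc : ¬ ∃ p, ∀ t, z t = p) :
    ∃ τ > 0, Function.Periodic z τ ∧ ∀ c, Function.Periodic z c → ∃ n : ℤ, c = n * τ := by
  let P : AddSubgroup ℝ :=
    { carrier := {c | Function.Periodic z c}
      zero_mem' := fun t ↦ by rw [add_zero]
      add_mem' := fun ha hb ↦ ha.add_period hb
      neg_mem' := fun ha ↦ ha.neg }
  rcases P.dense_or_cyclic with hd | ⟨a, ha⟩
  · refine absurd ⟨z 0, fun t ↦ ?_⟩ hnc
    refine congrFun (hz.ext_on hd (continuous_const (y := z 0)) fun c hc ↦ ?_) t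
    exact Function.Periodic.eq hc
  · have hmem : ∀ c, Function.Periodic z c ↔ ∃ n : ℤ, n • a = c := fun c ↦ by
      rw [← AddSubgroup.mem_closure_singleton, ← ha]; rfl
    have haP : Function.Periodic z a := (hmem a).mpr ⟨1, one_zsmul a⟩
    have ha0 : a ≠ 0 := by
      rintro rfl
      obtain ⟨n, hn⟩ := (hmem T).mp hper
      simp only [smul_zero] at hn
      exact hT.ne hn
    rcases ha0.lt_or_gt with h | h
    · refine ⟨-a, neg_pos.mpr h, haP.neg, fun c hc ↦ ?_⟩
      obtain ⟨n, rfl⟩ := (hmem c).mp hc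
      exact ⟨-n, by simp⟩
    · refine ⟨a, h, haP, fun c hc ↦ ?_⟩
      obtain ⟨n, rfl⟩ := (hmem c).mp hc
      exact ⟨n, by simp⟩

theorem exists_equilibrium_inside_periodic_orbit {g : ℂ → ℂ} (hg : ContDiff ℝ 1 g) {z : ℝ → ℂ}
    (hz : ∀ t, HasDerivAt z (g (z t)) t) {T : ℝ} (hT : 0 < T) (hper : Function.Periodic z T)
    (hnc : ¬ ∃ p, ∀ t, z t = p) :
    ∃ w, w ∉ range z ∧ g w = 0 ∧ Bornology.IsBounded (connectedComponentIn (range z)ᶜ w) := by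
  have hzc : Continuous z := continuous_iff_continuousAt.mpr fun t ↦ (hz t).continuousAt
  have hC : IsCompact (range z) := hper.compact_of_continuous hT.ne' hzc
  obtain ⟨Λ, hΛ⟩ := LocallyLipschitzOn.exists_lipschitzOnWith_of_compact hC
    (hg.locallyLipschitz.locallyLipschitzOn (s := range z))
  have hrange0 : ∀ w ∈ range z, g w ≠ 0 := by
    rintro _ ⟨s, rfl⟩ h0
    refine hnc ⟨z s, fun t ↦ ?_⟩
    exact congrFun (ODE_solution_unique_univ (v := fun _ ↦ g) (s := fun _ ↦ range z) (t₀ := s)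
      (g := fun _ ↦ z s) (fun _ ↦ hΛ) (fun t ↦ ⟨hz t, mem_range_self t⟩)
      (fun t ↦ ⟨by rw [h0]; exact hasDerivAt_const _ _, mem_range_self s⟩) rfl) t
  obtain ⟨τ, hτ, hτper, hτmin⟩ := hper.exists_minimal_period hzc hT hnc
  have hinj : ∀ s t, z s = z t → ∃ n : ℤ, t - s = n * τ := by
    intro s t hst
    refine hτmin _ fun u ↦ ?_
    have := congrFun (ODE_solution_unique_univ (v := fun _ ↦ g) (s := fun _ ↦ range z) (t₀ := s)
      (f := fun u ↦ z (u + (t - s))) (g := z) (fun _ ↦ hΛ)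
      (fun u ↦ ⟨(hz _).comp_add_const u _, mem_range_self _⟩)
      (fun u ↦ ⟨hz u, mem_range_self u⟩) (by simp [hst])) u
    exact this
  obtain ⟨K, hK, hCK, hKc, hKb⟩ := exists_isCompact_superset_isPreconnected_compl hC
  by_contra! hcon
  have hK0 : ∀ w ∈ K, g w ≠ 0 := by
    intro w hw h0
    by_cases hwC : w ∈ range z
    · exact hrange0 w hwC h0
    · exact hcon w hwC h0 (hKb w ⟨hw, hwC⟩)
  obtain ⟨l, hl, hle⟩ := hg.hasContinuousLogOn hK hKc hK0
  have hzK : ∀ t, z t ∈ K := fun t ↦ hCK (mem_range_self t)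
  exact not_exists_periodic_log_deriv hz (hg.continuous.comp hzc) hτ hτper hinj
    ⟨fun t ↦ l (z t), hl.comp_continuous hzc hzK, fun t ↦ congrArg l (hτper t), fun t ↦ hle _ (hzK t)⟩

theorem stmt18 (f : ℝ × ℝ → ℝ × ℝ) (hf : ContDiff ℝ 1 f)
    (γ : ℝ → ℝ × ℝ) (hγ : ∀ t : ℝ, HasDerivAt γ (f (γ t)) t)
    (T : ℝ) (hT : 0 < T) (hper : ∀ t : ℝ, γ (t + T) = γ t)
    (hnc : ¬ ∃ p : ℝ × ℝ, ∀ t : ℝ, γ t = p) :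
    ∃ x₀ : ℝ × ℝ, x₀ ∉ Set.range γ ∧ f x₀ = (0, 0) ∧
      Bornology.IsBounded (connectedComponentIn (Set.range γ)ᶜ x₀) := by
  let e : ℂ ≃L[ℝ] ℝ × ℝ := Complex.equivRealProdCLM
  have hγe : ∀ t, γ t = e (e.symm (γ t)) := fun t ↦ (e.apply_symm_apply _).symm
  have hrange : (range γ)ᶜ = e.toHomeomorph '' (range fun t ↦ e.symm (γ t))ᶜ := by
    rw [image_compl_eq e.toHomeomorph.bijective, ← range_comp]
    exact congrArg (fun φ ↦ (range φ)ᶜ) (funext hγe)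
  obtain ⟨w, hw, hw0, hwb⟩ := exists_equilibrium_inside_periodic_orbit
    (g := fun w ↦ e.symm (f (e w))) (z := fun t ↦ e.symm (γ t)) (T := T)
    (e.symm.contDiff.comp (hf.comp e.contDiff))
    (fun t ↦ by
      rw [← hγe]
      exact (e.symm : ℝ × ℝ →L[ℝ] ℂ).hasFDerivAt.comp_hasDerivAt t (hγ t))
    hT (fun t ↦ by simp only [hper t])
    (fun ⟨p, hp⟩ ↦ hnc ⟨e p, fun t ↦ by rw [hγe t, hp t]⟩)
  refine ⟨e w, ?_, ?_, ?_⟩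
  · rintro ⟨t, ht⟩
    exact hw ⟨t, by simp [ht]⟩
  · exact e.symm.map_eq_zero_iff.mp hw0
  · have := e.toHomeomorph.image_connectedComponentIn (s := (range fun t ↦ e.symm (γ t))ᶜ) hw
    rw [hrange]
    change Bornology.IsBounded (connectedComponentIn _ (e.toHomeomorph w))
    rw [← this]
    exact e.lipschitz.isBounded_image hwb
end

section
/- (Derivative of the Poincaré return map.) Let f : ℝ × ℝ → ℝ × ℝ, let Φ : ℝ → (ℝ × ℝ) → ℝ × ℝ satisfy, for every x and t, that s ↦ Φ(s)(x) has derivative f(Φ(t)(x)) at t, and suppose x ↦ Φ(t)(x) is differentiable. Let τ : ℝ × ℝ → ℝ have Fréchet derivative τ' at a point x₀, define P(x) = Φ(τ(x))(x), and let A be the Fréchet derivative at x₀ of the map x ↦ Φ(τ(x₀))(x) (the space derivative of the flow at time τ(x₀)). Assume the composite map x ↦ P(x) is differentiable at x₀ with derivative v ↦ (τ' v)·f(P(x₀)) + A v, assume the first component x ↦ (P(x))₁ is constant on a neighborhood of x₀, and assume (f(P(x₀)))₁ ≠ 0. Then for every direction v: τ' v = −(A v)₁ / (f(P(x₀)))₁,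 and the second component x ↦ (P(x))₂ has Fréchet derivative at x₀ given by v ↦ (A v)₂ − ((f(P(x₀)))₂ / (f(P(x₀)))₁) · (A v)₁. -/
theorem stmt19 (f : ℝ × ℝ → ℝ × ℝ) (Φ : ℝ → (ℝ × ℝ) → ℝ × ℝ)
    (hΦ : ∀ (x : ℝ × ℝ) (t : ℝ), HasDerivAt (fun s => Φ s x) (f (Φ t x)) t)
    (hΦdiff : ∀ t : ℝ, Differentiable ℝ (Φ t))
    (τ : ℝ × ℝ → ℝ) (x₀ : ℝ × ℝ) (τ' : (ℝ × ℝ) →L[ℝ] ℝ)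
    (hτ : HasFDerivAt τ τ' x₀)
    (P : ℝ × ℝ → ℝ × ℝ) (hP : P = fun x => Φ (τ x) x)
    (A : (ℝ × ℝ) →L[ℝ] ℝ × ℝ)
    (hA : HasFDerivAt (fun x => Φ (τ x₀) x) A x₀)
    (hPderiv : HasFDerivAt P (τ'.smulRight (f (P x₀)) + A) x₀)
    (hconst : ∀ᶠ x in nhds x₀, (P x).1 = (P x₀).1)
    (hf1 : (f (P x₀)).1 ≠ 0) :
    (∀ v : ℝ × ℝ, τ' v = -(A v).1 / (f (P x₀)).1) ∧
    HasFDerivAt (fun x => (P x).2)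
      ((ContinuousLinearMap.snd ℝ ℝ ℝ).comp A -
        ((f (P x₀)).2 / (f (P x₀)).1) • ((ContinuousLinearMap.fst ℝ ℝ ℝ).comp A)) x₀ := by
  have hfst : HasFDerivAt (fun x => (P x).1) (0 : (ℝ × ℝ) →L[ℝ] ℝ) x₀ :=
    (hasFDerivAt_const (P x₀).1 x₀).congr_of_eventuallyEq hconst
  have hτ' (v : ℝ × ℝ) : τ' v = -(A v).1 / (f (P x₀)).1 := by
    have h := DFunLike.congr_fun (hPderiv.fst.unique hfst) v
    have h : τ' v * (f (P x₀)).1 + (A v).1 = 0 := by simpa using h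
    rw [eq_div_iff hf1]
    linarith
  refine ⟨hτ', hPderiv.snd.congr_fderiv (ContinuousLinearMap.ext fun v => ?_)⟩
  change τ' v * (f (P x₀)).2 + (A v).2 =
    (A v).2 - (f (P x₀)).2 / (f (P x₀)).1 * (A v).1
  rw [hτ' v]
  ring
end
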